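/- arXiv:2507.13214 — 2 statements merged into one kernel-verified Lean document; each statement's English description precedes it below -/
import Mathlib

section
/- Let T be a column-injective tableau for w ∈ S_n, and let T' be an inversions tableau for w with T' = ↑_M T for some multiset M of boxes. Fix 1 ≤ i < k ≤ n such that T(i,k) is strictly less than the median of the entries of T on hook(i,k). Assume that for all r,j with 1 ≤ r < i < j ≤ n, the Λ-shape Λ(r,i,j) is balanced in T. Then (i,k) occurs in M. -/
open Classical

noncomputable section

/-- 1-based value of a permutation of `Fin n` at a 1-based position `j`. -/
def permVal {n : ℕ} (w : Equiv.Perm (Fin n)) (j : ℕ) : ℕ :=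
  if h : 1 ≤ j ∧ j ≤ n then (w ⟨j - 1, by omega⟩ : ℕ) + 1 else 0

/-- `(i,j)` is an inversion of `w`: `1 ≤ i < j ≤ n` and the (1-based) position of the
value `j` in the one-line notation of `w` precedes that of `i`. -/
def IsInv {n : ℕ} (w : Equiv.Perm (Fin n)) (i j : ℕ) : Prop :=
  1 ≤ i ∧ i < j ∧ j ≤ n ∧ permVal w.symm j < permVal w.symm i

/-- Lehmer form entry at box `(i,j)`: the number of `k ∈ [1, T(i,j)-1]` that do not
appear below box `(i,j)` in column `j`. -/
def lehmer (T : ℕ → ℕ → ℕ) (i j : ℕ) : ℕ :=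
  ((Finset.Ico 1 (T i j)).filter fun k => ∀ i', 1 ≤ i' → i' < i → T i' j ≠ k).card

/-- Incrementing box `(i,j)` of `T` yields `T'`:  with `a = T(i,j)` and `b` the smallest
integer greater than `a` not appearing below `(i,j)` in column `j`, either a pure
increment (if `b` is absent from column `j`) or a trade increment (swap `a` and `b`). -/
def IncrementAt (T T' : ℕ → ℕ → ℕ) (i j : ℕ) : Prop :=
  ∃ b, T i j < b ∧
    (∀ k, T i j < k → k < b → ∃ i', 1 ≤ i' ∧ i' < i ∧ T i' j = k) ∧
    (∀ i', 1 ≤ i' → i' < i → T i' j ≠ b) ∧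
    (((∀ i', 1 ≤ i' → T i' j ≠ b) ∧
        T' = fun a c => if a = i ∧ c = j then b else T a c) ∨
      (∃ i'', i < i'' ∧ T i'' j = b ∧
        T' = fun a c =>
          if a = i ∧ c = j then b else if a = i'' ∧ c = j then T i j else T a c))

/-- `IncBy M T T'`: `T'` is obtained from `T` by incrementing each box of the
multiset `M` (with multiplicity). -/
inductive IncBy : Multiset (ℕ × ℕ) → (ℕ → ℕ → ℕ) → (ℕ → ℕ → ℕ) → Prop
  | nil (T : ℕ → ℕ → ℕ) : IncBy 0 T T
  | cons {M : Multiset (ℕ × ℕ)} {T T' T'' : ℕ → ℕ → ℕ} {i j : ℕ} :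
      IncrementAt T T' i j → IncBy M T' T'' → IncBy ((i, j) ::ₘ M) T T''

/-- Column-injective tableau for `w`: a box has a nonzero entry iff it is an inversion
of `w`, and the nonzero entries in each column are distinct. -/
def ColInj {n : ℕ} (w : Equiv.Perm (Fin n)) (T : ℕ → ℕ → ℕ) : Prop :=
  (∀ i j, T i j ≠ 0 ↔ IsInv w i j) ∧
  ∀ i i' j, 1 ≤ i → i < i' → i' < j → T i j ≠ 0 → T i' j ≠ 0 → T i j ≠ T i' j

/-- The Λ-shape `Λ(i,j,k)` is balanced in `T`. -/
def LBal (T : ℕ → ℕ → ℕ) (i j k : ℕ) : Prop :=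
  min (T i j) (T j k) ≤ T i k ∧ T i k ≤ max (T i j) (T j k)

/-- Every Λ-shape of `Δ_{n-1}` is balanced in `T`. -/
def BalancedTab (n : ℕ) (T : ℕ → ℕ → ℕ) : Prop :=
  ∀ i j k, 1 ≤ i → i < j → j < k → k ≤ n → LBal T i j k

/-- Inversions tableau for `w`: balanced column-injective tableau whose entries in
row `i` are at most `i`. -/
def InvTab {n : ℕ} (w : Equiv.Perm (Fin n)) (T : ℕ → ℕ → ℕ) : Prop :=
  ColInj w T ∧ BalancedTab n T ∧ ∀ i j, T i j ≤ i

/-- The multiset of entries of `T` on `hook(i,k)`. -/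
def hookEntries (T : ℕ → ℕ → ℕ) (i k : ℕ) : Multiset ℕ :=
  (T i k ::ₘ (Finset.Ioo i k).val.map fun r => T r k) +
    (Finset.Ioo i k).val.map fun c => T i c

/-- The median ((k-i)-th smallest of the `2(k-i)-1` entries) of the hook of `(i,k)`. -/
def hookMedian (T : ℕ → ℕ → ℕ) (i k : ℕ) : ℕ :=
  ((hookEntries T i k).sort (· ≤ ·)).getD (k - i - 1) 0

/-- Nonzero entries in each column are distinct, and row `0` is empty. -/
def ColumnsInjective (T : ℕ → ℕ → ℕ) : Prop :=
  (∀ j, T 0 j = 0) ∧ ∀ i i' j, T i j ≠ 0 → T i j = T i' j → i = i'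

theorem ColInj.columnsInjective {n : ℕ} {w : Equiv.Perm (Fin n)} {T : ℕ → ℕ → ℕ}
    (hT : ColInj w T) : ColumnsInjective T := by
  constructor
  · intro j
    by_contra h
    exact absurd ((hT.1 0 j).1 h).1 (by omega)
  · intro i i' j h h'
    have h1 := (hT.1 i j).1 h
    have h2 := (hT.1 i' j).1 (h' ▸ h)
    rcases lt_trichotomy i i' with hlt | heq | hgt
    · exact absurd h' (hT.2 i i' j h1.1 hlt h2.2.1 h (h' ▸ h))
    · exact heq
    · exact absurd h'.symm (hT.2 i' i j h2.1 hgt h1.2.1 (h' ▸ h) h)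

/-- The support of column `j`, compared lexicographically from row `0` upwards. -/
def columnSupport (T : ℕ → ℕ → ℕ) (j : ℕ) : Lex (ℕ → Bool) :=
  toLex fun r => decide (T r j ≠ 0)

theorem columnSupport_eq_iff {T T' : ℕ → ℕ → ℕ} {j : ℕ} :
    columnSupport T j = columnSupport T' j ↔ ∀ r, T r j = 0 ↔ T' r j = 0 := by
  unfold columnSupport
  rw [toLex_inj, funext_iff]
  refine forall_congr' fun r => ?_
  rw [decide_eq_decide, not_iff_not]

theorem IncrementAt.eq_of_ne {T T' : ℕ → ℕ → ℕ} {i j : ℕ} (h : IncrementAt T T' i j)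
    {r c : ℕ} (hc : c ≠ j) : T' r c = T r c := by
  obtain ⟨b, -, -, -, ⟨-, rfl⟩ | ⟨i'', -, -, rfl⟩⟩ := h <;> simp [hc]

theorem IncrementAt.columnSupport_lt {T T' : ℕ → ℕ → ℕ} {i j : ℕ} (h : IncrementAt T T' i j)
    (h0 : T i j = 0) : columnSupport T j < columnSupport T' j := by
  obtain ⟨b, hb, -, -, ⟨-, rfl⟩ | ⟨i'', hi, -, rfl⟩⟩ := h
  · refine ⟨i, fun r hr => ?_, ?_⟩
    · simp [columnSupport, hr.ne]
    · have : b ≠ 0 := by omega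
      simp [columnSupport, h0, this]
  · refine ⟨i, fun r hr => ?_, ?_⟩
    · have : r ≠ i'' := by omega
      simp [columnSupport, hr.ne, this]
    · have : b ≠ 0 := by omega
      simp [columnSupport, h0, this]

theorem IncrementAt.columnSupport_eq {T T' : ℕ → ℕ → ℕ} {i j : ℕ} (h : IncrementAt T T' i j)
    (h0 : T i j ≠ 0) (c : ℕ) : columnSupport T c = columnSupport T' c := by
  rw [columnSupport_eq_iff]
  intro r
  obtain ⟨b, hb, -, -, ⟨-, rfl⟩ | ⟨i'', hi, hb', rfl⟩⟩ := h <;> grind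

theorem IncrementAt.columnSupport_le {T T' : ℕ → ℕ → ℕ} {i j : ℕ} (h : IncrementAt T T' i j)
    (c : ℕ) : columnSupport T c ≤ columnSupport T' c := by
  by_cases h0 : T i j = 0
  · by_cases hc : c = j
    · exact hc ▸ (h.columnSupport_lt h0).le
    · exact (columnSupport_eq_iff.2 fun r => by rw [h.eq_of_ne hc]).le
  · exact (h.columnSupport_eq h0 c).le

theorem IncBy.columnSupport_le {M : Multiset (ℕ × ℕ)} {T T' : ℕ → ℕ → ℕ} (h : IncBy M T T')
    (c : ℕ) : columnSupport T c ≤ columnSupport T' c := by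
  induction h with
  | nil T => exact le_rfl
  | cons h _ ih => exact (h.columnSupport_le c).trans ih

/-- On a nonzero entry, an increment exchanges the values `T i j` and `b` in column `j`. -/
theorem IncrementAt.exists_swap {T T' : ℕ → ℕ → ℕ} {i j : ℕ} (h : IncrementAt T T' i j)
    (hT : ColumnsInjective T) (h0 : T i j ≠ 0) :
    ∃ b, T i j < b ∧
      (∀ k, T i j < k → k < b → ∃ i', 1 ≤ i' ∧ i' < i ∧ T i' j = k) ∧
      (∀ i', 1 ≤ i' → i' < i → T i' j ≠ b) ∧
      ∀ r, T' r j = Equiv.swap (T i j) b (T r j) := by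
  obtain ⟨b, hb, hgap, hlow, hcase⟩ := h
  refine ⟨b, hb, hgap, hlow, fun r => ?_⟩
  have h1 := hT.1 j
  have h2 := hT.2
  rw [Equiv.swap_apply_def]
  obtain ⟨hpure, rfl⟩ | ⟨i'', hi, hb', rfl⟩ := hcase
  · have : T r j ≠ b := by
      rcases Nat.eq_zero_or_pos r with rfl | hr
      · omega
      · exact hpure r hr
    grind
  · grind

theorem ColumnsInjective.incrementAt {T T' : ℕ → ℕ → ℕ} {i j : ℕ} (hT : ColumnsInjective T)
    (h : IncrementAt T T' i j) (h0 : T i j ≠ 0) : ColumnsInjective T' := by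
  have hs : ∀ r c, T r c = 0 ↔ T' r c = 0 := fun r c =>
    columnSupport_eq_iff.1 (h.columnSupport_eq h0 c) r
  refine ⟨fun c => (hs 0 c).1 (hT.1 c), fun r r' c hr hrr' => ?_⟩
  by_cases hc : c = j
  · subst hc
    obtain ⟨b, -, -, -, hsw⟩ := h.exists_swap hT h0
    rw [hsw, hsw] at hrr'
    exact hT.2 _ _ _ (fun h => hr ((hs _ _).1 h)) (Equiv.injective _ hrr')
  · rw [h.eq_of_ne hc] at hr hrr'
    rw [h.eq_of_ne hc] at hrr'
    exact hT.2 _ _ _ hr hrr'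

theorem lehmer_congr {T T' : ℕ → ℕ → ℕ} {i j : ℕ} (h : ∀ r ≤ i, T' r j = T r j) :
    lehmer T' i j = lehmer T i j := by
  unfold lehmer
  rw [h i le_rfl]
  refine congrArg Finset.card (Finset.ext fun v => ?_)
  simp only [Finset.mem_filter]
  grind

theorem IncrementAt.lehmer_eq {T T' : ℕ → ℕ → ℕ} {i j : ℕ} (h : IncrementAt T T' i j)
    (hT : ColumnsInjective T) (h0 : T i j ≠ 0) {r c : ℕ} (hrc : (r, c) ≠ (i, j)) :
    lehmer T' r c = lehmer T r c := by
  by_cases hc : c = j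
  swap
  · exact lehmer_congr fun r _ => h.eq_of_ne hc
  subst hc
  obtain ⟨b, hb, hgap, hlow, hsw⟩ := h.exists_swap hT h0
  have hri : r ≠ i := fun h => hrc (by rw [h])
  have hT0 := hT.1 c
  have hT1 := hT.2
  have hi : 1 ≤ i := by
    by_contra hi
    have : i = 0 := by omega
    exact h0 (this ▸ hT0)
  rcases lt_or_gt_of_ne hri with hlt | hgt
  · refine lehmer_congr fun s hs => ?_
    rw [hsw, Equiv.swap_apply_of_ne_of_ne]
    · exact fun h => absurd (hT1 _ _ _ h0 h.symm) (by omega)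
    · rcases Nat.eq_zero_or_pos s with rfl | hs'
      · have := hT0
        omega
      · exact hlow s hs' (by omega)
  · unfold lehmer
    set σ := Equiv.swap (T i c) b with hσ
    have hfree : ∀ v, (∀ i', 1 ≤ i' → i' < r → T i' c ≠ v) → v ≠ 0 →
        (1 ≤ σ v ∧ (σ v < T' r c ↔ v < T r c)) := by
      intro v hv hv0
      have hva : v ≠ T i c := fun h => hv i hi hgt h.symm
      have hra : T r c ≠ T i c := fun h => hri (hT1 i r c h0 h.symm).symm
      have hgv : ¬ (T i c < v ∧ v < b) := by
        rintro ⟨h1, h2⟩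
        obtain ⟨i', h3, h4, h5⟩ := hgap v h1 h2
        exact hv i' h3 (by omega) h5
      have hgr : ¬ (T i c < T r c ∧ T r c < b) := by
        rintro ⟨h1, h2⟩
        obtain ⟨i', h3, h4, h5⟩ := hgap _ h1 h2
        have := hT1 i' r c (by omega) h5
        omega
      rw [hsw r, hσ, Equiv.swap_apply_def, Equiv.swap_apply_def]
      grind
    have hσσ : ∀ v, σ (σ v) = v := fun v => Equiv.swap_apply_self _ _ v
    have hσ0 : ∀ v, v ≠ 0 → σ v ≠ 0 := by
      intro v hv
      rw [hσ, Equiv.swap_apply_def]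
      grind
    refine Finset.card_nbij' (fun v => σ v) (fun v => σ v) ?_ ?_ ?_ ?_
    · intro v hv
      simp only [Finset.coe_filter, Finset.mem_Ico, Set.mem_ofPred_eq] at hv ⊢
      have hv0 : v ≠ 0 := by omega
      have hav : ∀ i', 1 ≤ i' → i' < r → T i' c ≠ σ v := by
        intro i' h1 h2 h3
        apply hv.2 i' h1 h2
        rw [hsw, h3, hσσ]
      have := hfree (σ v) hav (hσ0 v hv0)
      rw [hσσ] at this
      exact ⟨⟨Nat.pos_of_ne_zero (hσ0 v hv0), this.2.1 hv.1.2⟩, hav⟩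
    · intro v hv
      simp only [Finset.coe_filter, Finset.mem_Ico, Set.mem_ofPred_eq] at hv ⊢
      have := hfree v hv.2 (by omega)
      refine ⟨⟨this.1, this.2.2 hv.1.2⟩, fun i' h1 h2 h3 => hv.2 i' h1 h2 ?_⟩
      rw [hsw] at h3
      exact σ.injective h3
    · exact fun v _ => hσσ v
    · exact fun v _ => hσσ v

theorem IncrementAt.lehmer_le {T T' : ℕ → ℕ → ℕ} {i j : ℕ} (h : IncrementAt T T' i j)
    (hT : ColumnsInjective T) (h0 : T i j ≠ 0) (r c : ℕ) :
    lehmer T r c ≤ lehmer T' r c := by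
  by_cases hrc : (r, c) = (i, j)
  swap
  · exact (h.lehmer_eq hT h0 hrc).ge
  obtain ⟨rfl, rfl⟩ := Prod.mk.inj hrc
  obtain ⟨b, hb, hgap, hlow, hsw⟩ := h.exists_swap hT h0
  unfold lehmer
  have hr : T' r c = b := by rw [hsw, Equiv.swap_apply_left]
  have hlt : ∀ s, 1 ≤ s → s < r → T' s c = T s c := by
    intro s h1 h2
    rw [hsw, Equiv.swap_apply_of_ne_of_ne _ (hlow s h1 h2)]
    exact fun h => absurd (hT.2 _ _ _ h0 h.symm) (by omega)
  apply Finset.card_le_card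
  intro v hv
  simp only [Finset.mem_filter, Finset.mem_Ico] at hv ⊢
  refine ⟨⟨hv.1.1, by omega⟩, fun s h1 h2 => ?_⟩
  rw [hlt s h1 h2]
  exact hv.2 s h1 h2

theorem IncBy.lehmer_mono {M : Multiset (ℕ × ℕ)} {T T' : ℕ → ℕ → ℕ} (h : IncBy M T T')
    (hT : ColumnsInjective T) (hs : ∀ c, columnSupport T c = columnSupport T' c) (r c : ℕ) :
    lehmer T r c ≤ lehmer T' r c ∧ ((r, c) ∉ M → lehmer T r c = lehmer T' r c) := by
  induction h with
  | nil T => exact ⟨le_rfl, fun _ => rfl⟩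
  | @cons M T T₁ T' i j h h' ih =>
    have h0 : T i j ≠ 0 := fun h0 =>
      ((h.columnSupport_lt h0).trans_le (h'.columnSupport_le j)).ne (hs j)
    have ih := ih (hT.incrementAt h h0) fun c => (h.columnSupport_eq h0 c).symm.trans (hs c)
    refine ⟨(h.lehmer_le hT h0 r c).trans ih.1, fun hM => ?_⟩
    rw [Multiset.mem_cons, not_or] at hM
    rw [← h.lehmer_eq hT h0 hM.1, ih.2 hM.2]

/-- The number of values in `[1, x - 1]` not attained by `f` on rows `1, …, m - 1`. -/
def freeCount (f : ℕ → ℕ) (m x : ℕ) : ℕ :=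
  ((Finset.Ico 1 x).filter fun v => ∀ r, 1 ≤ r → r < m → f r ≠ v).card

theorem freeCount_mono (f : ℕ → ℕ) (m : ℕ) {x y : ℕ} (h : x ≤ y) :
    freeCount f m x ≤ freeCount f m y := by
  refine Finset.card_le_card fun v hv => ?_
  simp only [Finset.mem_filter, Finset.mem_Ico] at hv ⊢
  exact ⟨⟨hv.1.1, hv.1.2.trans_le h⟩, hv.2⟩

theorem freeCount_lt (f : ℕ → ℕ) (m : ℕ) {x y : ℕ} (hx : x ≠ 0) (h : x < y)
    (hf : ∀ r, 1 ≤ r → r < m → f r ≠ x) : freeCount f m x < freeCount f m y := by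
  refine Finset.card_lt_card ((Finset.ssubset_iff_of_subset ?_).2 ⟨x, ?_, ?_⟩)
  · intro v hv
    simp only [Finset.mem_filter, Finset.mem_Ico] at hv ⊢
    exact ⟨⟨hv.1.1, hv.1.2.trans h⟩, hv.2⟩
  · simp only [Finset.mem_filter, Finset.mem_Ico]
    exact ⟨⟨by omega, h⟩, hf⟩
  · simp

theorem freeCount_add_card {f : ℕ → ℕ} (hf : ∀ r s, f r ≠ 0 → f r = f s → r = s) (m x : ℕ) :
    freeCount f m x + ((Finset.Ico 1 m).filter fun r => f r ≠ 0 ∧ f r < x).card = x - 1 := by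
  have himg : ((Finset.Ico 1 m).filter fun r => f r ≠ 0 ∧ f r < x).card =
      ((Finset.Ico 1 x).filter fun v => ¬ ∀ r, 1 ≤ r → r < m → f r ≠ v).card := by
    refine Finset.card_nbij f ?_ ?_ ?_
    · intro r hr
      simp only [Finset.coe_filter, Finset.mem_Ico, Set.mem_ofPred_eq] at hr ⊢
      exact ⟨⟨by omega, hr.2.2⟩, fun h => h r hr.1.1 hr.1.2 rfl⟩
    · intro r hr s _ hrs
      simp only [Finset.coe_filter, Set.mem_ofPred_eq] at hr
      exact hf r s hr.2.1 hrs
    · intro v hv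
      simp only [Finset.coe_filter, Finset.mem_Ico, Set.mem_ofPred_eq] at hv
      obtain ⟨⟨h1, h2⟩, h3⟩ := hv
      push Not at h3
      obtain ⟨r, hr1, hr2, rfl⟩ := h3
      refine ⟨r, ?_, rfl⟩
      simp only [Finset.coe_filter, Finset.mem_Ico, Set.mem_ofPred_eq]
      exact ⟨⟨hr1, hr2⟩, by omega, h2⟩
  rw [himg, ← Nat.card_Ico 1 x, freeCount]
  convert Finset.card_filter_add_card_filter_not (s := Finset.Ico 1 x)
    fun v => ∀ r, 1 ≤ r → r < m → f r ≠ v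

theorem freeCount_succ {f : ℕ → ℕ} (hf : ∀ r s, f r ≠ 0 → f r = f s → r = s) {m : ℕ}
    (hm : 1 ≤ m) (x : ℕ) :
    freeCount f (m + 1) x + (if f m ≠ 0 ∧ f m < x then 1 else 0) = freeCount f m x := by
  have h1 := freeCount_add_card hf m x
  have h2 := freeCount_add_card hf (m + 1) x
  have h3 : Finset.Ico 1 (m + 1) = insert m (Finset.Ico 1 m) := by
    ext r
    simp only [Finset.mem_Ico, Finset.mem_insert]
    omega
  rw [h3, Finset.filter_insert] at h2
  split_ifs at h2 ⊢ with h
  · rw [Finset.card_insert_of_notMem (by simp)] at h2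
    omega
  · omega

theorem freeCount_self_lt_iff {f : ℕ → ℕ} (hf : ∀ r s, f r ≠ 0 → f r = f s → r = s) {m : ℕ}
    (hm : f m ≠ 0) (x : ℕ) : freeCount f m (f m) < freeCount f m x ↔ f m < x := by
  constructor
  · intro h
    by_contra hx
    exact absurd (freeCount_mono f m (not_lt.1 hx)) (not_le.2 h)
  · intro h
    exact freeCount_lt f m hm h fun r _ hr he => absurd (hf m r hm he.symm) (by omega)

/-- In a column, raising the Lehmer form above row `i` while keeping it at row `i` cannot
increase the number of smaller entries above row `i`. -/
theorem card_smaller_above_le {f g : ℕ → ℕ} (hf : ∀ r s, f r ≠ 0 → f r = f s → r = s)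
    (hg : ∀ r s, g r ≠ 0 → g r = g s → r = s) (hfg : ∀ r, f r = 0 ↔ g r = 0)
    (hle : ∀ r, freeCount f r (f r) ≤ freeCount g r (g r)) {i : ℕ} (hi : 1 ≤ i)
    (heq : freeCount f i (f i) = freeCount g i (g i)) (m : ℕ) (him : i < m) :
    ((Finset.Ioo i m).filter fun r => g r ≠ 0 ∧ g r < g i).card ≤
      ((Finset.Ioo i m).filter fun r => f r ≠ 0 ∧ f r < f i).card := by
  have hcount : ∀ h : ℕ → ℕ, (∀ r s, h r ≠ 0 → h r = h s → r = s) → ∀ m, i < m →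
      ((Finset.Ioo i m).filter fun r => h r ≠ 0 ∧ h r < h i).card + freeCount h m (h i) =
        freeCount h i (h i) := by
    intro h hh m him
    induction m, him using Nat.le_induction with
    | base =>
      have h1 := freeCount_succ hh hi (h i)
      have h2 : Finset.Ioo i (i + 1) = ∅ := by
        ext
        simp
      simpa [h2] using h1
    | succ m hm ih =>
      have h1 := freeCount_succ hh (show 1 ≤ m by omega) (h i)
      have h3 : Finset.Ioo i (m + 1) = insert m (Finset.Ioo i m) := by
        ext r
        simp only [Finset.mem_Ioo, Finset.mem_insert]
        omega
      rw [h3, Finset.filter_insert]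
      split_ifs at h1 ⊢ with h
      · rw [Finset.card_insert_of_notMem (by simp)]
        omega
      · omega
  suffices hfree : freeCount f m (f i) ≤ freeCount g m (g i) by
    have h1 := hcount f hf m him
    have h2 := hcount g hg m him
    omega
  induction m, him using Nat.le_induction with
  | base =>
    have h1 := freeCount_succ hf hi (f i)
    have h2 := freeCount_succ hg hi (g i)
    simp only [lt_irrefl, and_false, if_false, add_zero] at h1 h2
    change freeCount f (i + 1) (f i) ≤ freeCount g (i + 1) (g i)
    omega
  | succ m hm ih =>
    have h1 := freeCount_succ hf (show 1 ≤ m by omega) (f i)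
    have h2 := freeCount_succ hg (show 1 ≤ m by omega) (g i)
    have h3 := hle m
    have h4 := fun h => freeCount_self_lt_iff hf (m := m) h (f i)
    have h5 := fun h => freeCount_self_lt_iff hg (m := m) h (g i)
    have h6 := hfg m
    by_cases hgm : g m ≠ 0 ∧ g m < g i
    · have hfm : f m ≠ 0 := fun h => hgm.1 (h6.1 h)
      have h5 := (h5 hgm.1).2 hgm.2
      have h4 := h4 hfm
      rw [if_pos hgm] at h2
      split_ifs at h1 with hfi
      · omega
      · have : ¬ f m < f i := fun h => hfi ⟨hfm, h⟩
        omega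
    · rw [if_neg hgm] at h2
      omega

/-- If the Λ-shapes `Λ(r,i,j)` are balanced, the Lehmer form at `(i,j)` is determined by the
value there, column `i`, and the support of the tableau. -/
theorem lehmer_add_card_eq_freeCount {T : ℕ → ℕ → ℕ} (hT : ColumnsInjective T) {i j : ℕ}
    (hij : T i j ≠ 0) (hbal : ∀ r, 1 ≤ r → r < i → LBal T r i j) :
    lehmer T i j + ((Finset.Ico 1 i).filter fun r => T r i = 0 ∧ T r j ≠ 0).card =
      freeCount (fun r => T r i) i (T i j) := by
  have h1 := freeCount_add_card (f := fun r => T r j) (fun r s => hT.2 r s j) i (T i j)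
  have h2 := freeCount_add_card (f := fun r => T r i) (fun r s => hT.2 r s i) i (T i j)
  have h3 : ((Finset.Ico 1 i).filter fun r => T r j ≠ 0 ∧ T r j < T i j) =
      ((Finset.Ico 1 i).filter fun r => T r i = 0 ∧ T r j ≠ 0) ∪
      ((Finset.Ico 1 i).filter fun r => T r i ≠ 0 ∧ T r i < T i j) := by
    rw [← Finset.filter_or]
    refine Finset.filter_congr fun r hr => ?_
    rw [Finset.mem_Ico] at hr
    obtain ⟨h4, h5⟩ := hbal r hr.1 hr.2
    have h6 : T r j ≠ T i j := fun h => by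
      have := hT.2 i r j hij h.symm
      omega
    omega
  have h4 : Disjoint ((Finset.Ico 1 i).filter fun r => T r i = 0 ∧ T r j ≠ 0)
      ((Finset.Ico 1 i).filter fun r => T r i ≠ 0 ∧ T r i < T i j) := by
    rw [Finset.disjoint_filter]
    tauto
  simp only [h3, Finset.card_union_of_disjoint h4] at h1
  have h5 : lehmer T i j = freeCount (fun r => T r j) i (T i j) := rfl
  omega

/-- If at least `p + 1` elements of `s` are at most `a`, the `(p + 1)`-st smallest is. -/
theorem getD_sort_le {s : Multiset ℕ} {a p : ℕ} (h : p < s.countP (· ≤ a)) :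
    (s.sort (· ≤ ·)).getD p 0 ≤ a := by
  by_contra! hlt
  set l := s.sort (· ≤ ·) with hl
  have hp : p < l.length := by
    by_contra hp
    rw [List.getD_eq_default _ _ (not_lt.1 hp)] at hlt
    omega
  rw [List.getD_eq_getElem _ _ hp] at hlt
  have hsorted : l.Pairwise (· ≤ ·) := Multiset.pairwise_sort s (· ≤ ·)
  have hcount : s.countP (· ≤ a) = l.countP (fun x => decide (x ≤ a)) := by
    conv_lhs => rw [← Multiset.sort_eq s (· ≤ ·)]
    rw [Multiset.coe_countP]
  rw [hcount, ← List.take_append_drop p l, List.countP_append] at h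
  have h1 : (l.take p).countP (fun x => decide (x ≤ a)) ≤ p :=
    List.countP_le_length.trans (by simp)
  have h2 : (l.drop p).countP (fun x => decide (x ≤ a)) = 0 := by
    rw [List.countP_eq_zero]
    intro x hx
    obtain ⟨q, hq, rfl⟩ := List.mem_iff_getElem.1 hx
    rw [List.getElem_drop]
    have : l[p] ≤ l[p + q]'(by simp at hq; omega) :=
      hsorted.rel_get_of_le (a := ⟨p, hp⟩) (b := ⟨p + q, by simp at hq; omega⟩) (by simp)
    simp only [decide_eq_true_eq]
    omega
  omega

theorem countP_hookEntries (T : ℕ → ℕ → ℕ) (i k : ℕ) :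
    (hookEntries T i k).countP (· ≤ T i k) =
      1 + ((Finset.Ioo i k).filter fun r => T r k ≤ T i k).card +
        ((Finset.Ioo i k).filter fun c => T i c ≤ T i k).card := by
  unfold hookEntries
  rw [Multiset.countP_add, Multiset.countP_cons_of_pos (p := (· ≤ T i k)) _ le_rfl, Multiset.countP_map,
    Multiset.countP_map]
  simp only [Finset.card_def, Finset.filter_val]
  omega

/-- If `T(i,k)` is strictly less than the median of the hook entries and
all Λ-shapes `Λ(r,i,j)` with `r < i` are balanced in `T`, then `(i,k)` occurs in `M`. -/
theorem mem_of_lt_hookMedian {n : ℕ} (w : Equiv.Perm (Fin n)) (T T' : ℕ → ℕ → ℕ)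
    (hT : ColInj w T) (hT' : InvTab w T') (M : Multiset (ℕ × ℕ)) (hM : IncBy M T T')
    (i k : ℕ) (hi : 1 ≤ i) (hik : i < k) (hkn : k ≤ n)
    (hmed : T i k < hookMedian T i k)
    (hbal : ∀ r j, 1 ≤ r → r < i → i < j → j ≤ n → LBal T r i j) :
    (i, k) ∈ M := by
  by_contra hmem
  have hTc := hT.columnsInjective
  have hTc' := hT'.1.columnsInjective
  have hsupp : ∀ r c, T r c = 0 ↔ T' r c = 0 := fun r c => by
    rw [← not_iff_not]
    exact (hT.1 r c).trans (hT'.1.1 r c).symm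
  have hleh := hM.lehmer_mono hTc fun c => columnSupport_eq_iff.2 fun r => hsupp r c
  have heq := (hleh i k).2 hmem
  have hrow : ∀ j ∈ Finset.Ioo i k, T' i j ≤ T' i k → T i j ≤ T i k := by
    intro j hj hle
    rw [Finset.mem_Ioo] at hj
    by_contra! hlt
    have hk : T i k ≠ 0 := fun h => by
      have h1 := (hsupp i k).1 h
      have h2 := (hsupp i j).2 (by omega)
      omega
    have hk' : T' i k ≠ 0 := fun h => hk ((hsupp i k).2 h)
    have hj0 : T i j ≠ 0 := by omega
    have hj0' : T' i j ≠ 0 := fun h => hj0 ((hsupp i j).2 h)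
    have e1 := lehmer_add_card_eq_freeCount hTc hk fun r h1 h2 => hbal r k h1 h2 hik hkn
    have e2 := lehmer_add_card_eq_freeCount hTc hj0 fun r h1 h2 =>
      hbal r j h1 h2 hj.1 (by omega)
    have e3 := lehmer_add_card_eq_freeCount hTc' hk' fun r h1 h2 => hT'.2.1 r i k h1 h2 hik hkn
    have e4 := lehmer_add_card_eq_freeCount hTc' hj0' fun r h1 h2 =>
      hT'.2.1 r i j h1 h2 hj.1 (by omega)
    simp only [← hsupp, ne_eq] at e1 e2 e3 e4
    have hlt' : freeCount (fun r => T r i) i (T i k) < freeCount (fun r => T r i) i (T i j) := by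
      refine freeCount_lt _ i hk hlt fun r h1 h2 h3 => ?_
      obtain ⟨h4, h5⟩ := hbal r k h1 h2 hik hkn
      rw [h3, min_self] at h4
      rw [h3, max_self] at h5
      have := hTc.2 i r k hk (by omega)
      omega
    have hle' := freeCount_mono (fun r => T' r i) i hle
    have := (hleh i j).1
    omega
  have hcol : ((Finset.Ioo i k).filter fun r => T' r k ≤ T' i k).card ≤
      ((Finset.Ioo i k).filter fun r => T r k ≤ T i k).card := by
    have hsplit : ∀ S : ℕ → ℕ → ℕ, ColumnsInjective S →
        ((Finset.Ioo i k).filter fun r => S r k ≤ S i k).card =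
          ((Finset.Ioo i k).filter fun r => S r k = 0).card +
          ((Finset.Ioo i k).filter fun r => S r k ≠ 0 ∧ S r k < S i k).card := by
      intro S hS
      rw [← Finset.card_union_of_disjoint, ← Finset.filter_or]
      · congr 1
        refine Finset.filter_congr fun r hr => ?_
        rw [Finset.mem_Ioo] at hr
        have h1 : S r k ≠ 0 → S r k ≠ S i k := fun h h' => by
          have := hS.2 r i k h h'
          omega
        omega
      · rw [Finset.disjoint_filter]
        tauto
    rw [hsplit T hTc, hsplit T' hTc']
    have := card_smaller_above_le (f := fun r => T r k) (g := fun r => T' r k)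
      (fun r s => hTc.2 r s k) (fun r s => hTc'.2 r s k) (fun r => hsupp r k)
      (fun r => (hleh r k).1) hi heq k hik
    simp only [← hsupp, ne_eq] at this ⊢
    omega
  have hrow' : ((Finset.Ioo i k).filter fun c => T' i c ≤ T' i k).card ≤
      ((Finset.Ioo i k).filter fun c => T i c ≤ T i k).card :=
    Finset.card_le_card fun c hc => by
      rw [Finset.mem_filter] at hc ⊢
      exact ⟨hc.1, hrow c hc.1 hc.2⟩
  have hhook : k - i - 1 ≤ ((Finset.Ioo i k).filter fun r => T' r k ≤ T' i k).card +
      ((Finset.Ioo i k).filter fun c => T' i c ≤ T' i k).card := by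
    rw [← Nat.card_Ioo]
    refine le_trans (Finset.card_le_card ?_) (Finset.card_union_le _ _)
    intro j hj
    rw [← Finset.filter_or, Finset.mem_filter]
    refine ⟨hj, ?_⟩
    rw [Finset.mem_Ioo] at hj
    have := (hT'.2.1 i j k hi hj.1 hj.2 hkn).1
    omega
  refine absurd hmed (not_lt.2 (getD_sort_le ?_))
  rw [countP_hookEntries]
  omega
end
end

section
/- For every permutation w ∈ S_n, the map Φ : PD(w) → LT(w) is a poset isomorphism from the chute move poset on reduced pipe dreams for w to the set of Lehmer tableaux for w ordered by componentwise comparison. -/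
open Classical

noncomputable section

/-! ## Pipe dreams

A pipe dream in the staircase `Δ_n` is encoded by `P : ℕ → ℕ → Bool`, where
`P i j = true` means box `(i,j)` (row `i` from the top, column `j` from the left,
with `1 ≤ i, j` and `i + j ≤ n`) is a cross tile, and `false` means a bump tile;
boxes on the southeast boundary (`i + j = n + 1`) are elbow tiles. -/

/-- `labels n P i j` is the pair (label of the north edge, label of the east edge) of
the pipes passing through box `(i,j)`:  pipes enter at row `k` on the west side with
label `k` and propagate through cross, bump and elbow tiles. -/
def labels (n : ℕ) (P : ℕ → ℕ → Bool) (i j : ℕ) : ℕ × ℕ :=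
  let west := if _h1 : j ≤ 1 then i else (labels n P i (j - 1)).2
  if _h : i + j ≤ n then
    if P i j then ((labels n P (i + 1) j).1, west)
    else (west, (labels n P (i + 1) j).1)
  else (west, west)
termination_by (n + 1 - i) + j
decreasing_by all_goals omega

def northLabel (n : ℕ) (P : ℕ → ℕ → Bool) (i j : ℕ) : ℕ := (labels n P i j).1

def westLabel (n : ℕ) (P : ℕ → ℕ → Bool) (i j : ℕ) : ℕ :=
  if j ≤ 1 then i else (labels n P i (j - 1)).2

def southLabel (n : ℕ) (P : ℕ → ℕ → Bool) (i j : ℕ) : ℕ := (labels n P (i + 1) j).1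

/-- Pipes `p` and `q` cross at box `(i,j)` of `P`. -/
def CrossAt (n : ℕ) (P : ℕ → ℕ → Bool) (i j p q : ℕ) : Prop :=
  1 ≤ i ∧ 1 ≤ j ∧ i + j ≤ n ∧ P i j = true ∧
    ((westLabel n P i j = p ∧ southLabel n P i j = q) ∨
      (westLabel n P i j = q ∧ southLabel n P i j = p))

/-- `P` is a pipe dream for `w`: crosses lie in the staircase, and reading the pipe
labels along the north side gives the one-line notation of `w`. -/
def IsPD {n : ℕ} (w : Equiv.Perm (Fin n)) (P : ℕ → ℕ → Bool) : Prop :=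
  (∀ i j, P i j = true → 1 ≤ i ∧ 1 ≤ j ∧ i + j ≤ n) ∧
    ∀ j, 1 ≤ j → j ≤ n → northLabel n P 1 j = permVal w j

/-- `P` is reduced: no two pipes cross more than once. -/
def Reduced (n : ℕ) (P : ℕ → ℕ → Bool) : Prop :=
  ∀ p q i j i' j', CrossAt n P i j p q → CrossAt n P i' j' p q → i = i' ∧ j = j'

/-- The set of reduced pipe dreams for `w`. -/
def RPD {n : ℕ} (w : Equiv.Perm (Fin n)) :=
  { P : ℕ → ℕ → Bool // IsPD w P ∧ Reduced n P }

/-- `R` is a rectangle (rows `a < b`, columns `c < d`) in which a chute move of `P`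
can take place: `NW(R)=(a,c)` and `SW(R)=(b,c)` are bumps, `SE(R)=(b,d)` is a bump or
elbow, and all other boxes of `R` are crosses. -/
def IsChuteRect (n : ℕ) (P : ℕ → ℕ → Bool) (a b c d : ℕ) : Prop :=
  1 ≤ a ∧ a < b ∧ 1 ≤ c ∧ c < d ∧ b + d ≤ n + 1 ∧
    P a c = false ∧ P b c = false ∧ P b d = false ∧
    ∀ i j, a ≤ i → i ≤ b → c ≤ j → j ≤ d →
      ¬(i = a ∧ j = c) → ¬(i = b ∧ j = c) → ¬(i = b ∧ j = d) → P i j = true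

/-- The result of the chute move in the rectangle with corners `(a,c)`, `(b,d)`:
the bump at `SW=(b,c)` becomes a cross and the cross at `NE=(a,d)` becomes a bump. -/
def chuteResult (P : ℕ → ℕ → Bool) (a b c d : ℕ) : ℕ → ℕ → Bool :=
  fun i j => if i = b ∧ j = c then true else if i = a ∧ j = d then false else P i j

/-- `P'` is obtained from `P` by a single chute move. -/
def ChuteStep (n : ℕ) (P P' : ℕ → ℕ → Bool) : Prop :=
  ∃ a b c d, IsChuteRect n P a b c d ∧ P' = chuteResult P a b c d

/-- The chute move order on `RPD w`: `P ≤ Q` iff `Q` is obtained from `P`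
by a sequence of chute moves. -/
def chuteLE {n : ℕ} (w : Equiv.Perm (Fin n)) (P Q : RPD w) : Prop :=
  Relation.ReflTransGen (fun X Y : RPD w => ChuteStep n X.1 Y.1) P Q

/-- `theta n P p q` is the index of the row in which pipes `p` and `q` cross in `P`
(`0` if they do not cross).  For `P ∈ PD(w)` reduced, `theta n P` is the inversions
tableau `Θ(P)`. -/
def theta (n : ℕ) (P : ℕ → ℕ → Bool) (p q : ℕ) : ℕ :=
  if h : ∃ rc : ℕ × ℕ, CrossAt n P rc.1 rc.2 p q then (Classical.choose h).1 else 0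

/-- The Lehmer tableau `Φ(P) = Λ(Θ(P))` of a pipe dream. -/
def phi (n : ℕ) (P : ℕ → ℕ → Bool) (i j : ℕ) : ℕ := lehmer (theta n P) i j

/-- Cover relation of the chute move order. -/
def chuteCovBy {n : ℕ} (w : Equiv.Perm (Fin n)) (P Q : RPD w) : Prop :=
  chuteLE w P Q ∧ P ≠ Q ∧ ∀ R, chuteLE w P R → chuteLE w R Q → R = P ∨ R = Q

/-- The interval `[P, Q]` in the chute move order. -/
def chuteIcc {n : ℕ} (w : Equiv.Perm (Fin n)) (P Q : RPD w) : Set (RPD w) :=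
  { R | chuteLE w P R ∧ chuteLE w R Q }

/-- A chain in the chute move order. -/
def chuteChain {n : ℕ} (w : Equiv.Perm (Fin n)) (C : Set (RPD w)) : Prop :=
  ∀ x ∈ C, ∀ y ∈ C, chuteLE w x y ∨ chuteLE w y x

/-- `[P,Q]` is a polygon: an interval of cardinality at least 4 that is the union of
two chains whose intersection is `{P, Q}`. -/
def IsPolygon {n : ℕ} (w : Equiv.Perm (Fin n)) (P Q : RPD w) : Prop :=
  chuteLE w P Q ∧ 4 ≤ (chuteIcc w P Q).ncard ∧
    ∃ C₁ C₂ : Set (RPD w), chuteChain w C₁ ∧ chuteChain w C₂ ∧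
      C₁ ∪ C₂ = chuteIcc w P Q ∧ C₁ ∩ C₂ = {P, Q}

/-- `m` is the meet (greatest lower bound) of `P` and `Q` in the chute move order. -/
def IsMeetOf {n : ℕ} (w : Equiv.Perm (Fin n)) (m P Q : RPD w) : Prop :=
  chuteLE w m P ∧ chuteLE w m Q ∧ ∀ r, chuteLE w r P → chuteLE w r Q → chuteLE w r m

/-- `s` is the join (least upper bound) of `P` and `Q` in the chute move order. -/
def IsJoinOf {n : ℕ} (w : Equiv.Perm (Fin n)) (s P Q : RPD w) : Prop :=
  chuteLE w P s ∧ chuteLE w Q s ∧ ∀ r, chuteLE w P r → chuteLE w Q r → chuteLE w s r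

/-- The number of `i ∈ [l, p)` whose entry in column `j` of `T` lies in `[1, t]`. -/
def colCount (T : ℕ → ℕ → ℕ) (l p j t : ℕ) : ℕ :=
  ((Finset.Ico l p).filter fun i => 0 < T i j ∧ T i j ≤ t).card

/-- The properties of an inversions tableau, imposed only on boxes `(i, j)` with
`1 ≤ i < j ≤ n`. -/
structure Tableau (n : ℕ) (T : ℕ → ℕ → ℕ) : Prop where
  bal : ∀ i j k, 1 ≤ i → i < j → j < k → k ≤ n →
    min (T i j) (T j k) ≤ T i k ∧ T i k ≤ max (T i j) (T j k)
  inj : ∀ i i' j, 1 ≤ i → i < i' → i' < j → j ≤ n → T i j ≠ 0 → T i j ≠ T i' j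

theorem colCount_split (T : ℕ → ℕ → ℕ) {l m p : ℕ} (j t : ℕ) (h₁ : l ≤ m) (h₂ : m < p) :
    colCount T l p j t =
      colCount T l m j t + (if 0 < T m j ∧ T m j ≤ t then 1 else 0) +
        colCount T (m + 1) p j t := by
  unfold colCount
  rw [← Finset.Ico_union_Ico_eq_Ico h₁ h₂.le, Finset.filter_union,
    Finset.card_union_of_disjoint, ← Finset.insert_Ico_succ_left_eq_Ico h₂,
    Finset.filter_insert]
  · split_ifs with h
    · rw [Finset.card_insert_of_notMem (by simp)]
      simp only [Order.succ_eq_add_one]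
      omega
    · rfl
  · apply Finset.disjoint_filter_filter
    exact Finset.Ico_disjoint_Ico_consecutive l m p

theorem colCount_le_of_imp {T U : ℕ → ℕ → ℕ} {l p j k s t : ℕ}
    (h : ∀ i, l ≤ i → i < p → 0 < T i j → T i j ≤ s → 0 < U i k ∧ U i k ≤ t) :
    colCount T l p j s ≤ colCount U l p k t := by
  apply Finset.card_le_card
  intro i
  simp only [Finset.mem_filter, Finset.mem_Ico]
  rintro ⟨⟨h₁, h₂⟩, h₃, h₄⟩
  exact ⟨⟨h₁, h₂⟩, h i h₁ h₂ h₃ h₄⟩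

/-- Pointwise comparison extracted from a comparison of sums of column counts. -/
theorem exists_of_colCount_lt {T₁ T₂ T₃ T₄ : ℕ → ℕ → ℕ} {p j₁ j₂ j₃ j₄ t₁ t₂ t₃ t₄ : ℕ}
    (h : colCount T₁ 1 p j₁ t₁ + colCount T₂ 1 p j₂ t₂ <
      colCount T₃ 1 p j₃ t₃ + colCount T₄ 1 p j₄ t₄) :
    ∃ e, 1 ≤ e ∧ e < p ∧
      (if 0 < T₁ e j₁ ∧ T₁ e j₁ ≤ t₁ then 1 else 0) +
        (if 0 < T₂ e j₂ ∧ T₂ e j₂ ≤ t₂ then 1 else 0) <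
      (if 0 < T₃ e j₃ ∧ T₃ e j₃ ≤ t₃ then 1 else 0) +
        (if 0 < T₄ e j₄ ∧ T₄ e j₄ ≤ t₄ then 1 else 0) := by
  unfold colCount at h
  simp only [Finset.card_filter, ← Finset.sum_add_distrib] at h
  obtain ⟨e, he, hlt⟩ := Finset.exists_lt_of_sum_lt h
  rw [Finset.mem_Ico] at he
  exact ⟨e, he.1, he.2, hlt⟩

theorem le_colCount_of_full {T : ℕ → ℕ → ℕ} {p j s t : ℕ} (hst : s ≤ t)
    (h : ∀ r, s < r → r ≤ t → ∃ i, 1 ≤ i ∧ i < p ∧ T i j = r) :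
    colCount T 1 p j s + (t - s) ≤ colCount T 1 p j t := by
  have key : Finset.Ioc s t ⊆
      ((Finset.Ico 1 p).filter fun i => s < T i j ∧ T i j ≤ t).image fun i => T i j := by
    intro r hr
    rw [Finset.mem_Ioc] at hr
    obtain ⟨i, h₁, h₂, h₃⟩ := h r hr.1 hr.2
    simp only [Finset.mem_image, Finset.mem_filter, Finset.mem_Ico]
    exact ⟨i, ⟨⟨h₁, h₂⟩, by omega⟩, h₃⟩
  have h₁ := (Finset.card_le_card key).trans Finset.card_image_le
  rw [Nat.card_Ioc] at h₁
  have h₂ : colCount T 1 p j s + ((Finset.Ico 1 p).filter fun i => s < T i j ∧ T i j ≤ t).card ≤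
      colCount T 1 p j t := by
    unfold colCount
    rw [← Finset.card_union_of_disjoint]
    · apply Finset.card_le_card
      intro i
      simp only [Finset.mem_union, Finset.mem_filter, Finset.mem_Ico]
      omega
    · apply Finset.disjoint_filter.2
      intro i _ h₁ h₂
      omega
  omega

namespace Tableau

variable {n : ℕ} {T U : ℕ → ℕ → ℕ}

theorem colCount_le_add_sub (hT : Tableau n T) {p j s t : ℕ} (hp : p ≤ j) (hj : j ≤ n) (_ : s ≤ t) :
    colCount T 1 p j t ≤ colCount T 1 p j s + (t - s) := by
  have h₁ : colCount T 1 p j t ≤ colCount T 1 p j s +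
      ((Finset.Ico 1 p).filter fun i => s < T i j ∧ T i j ≤ t).card := by
    unfold colCount
    refine le_trans (Finset.card_le_card ?_) (Finset.card_union_le _ _)
    intro i
    simp only [Finset.mem_union, Finset.mem_filter, Finset.mem_Ico]
    omega
  have h₂ : ((Finset.Ico 1 p).filter fun i => s < T i j ∧ T i j ≤ t).card ≤
      (Finset.Ioc s t).card := by
    apply Finset.card_le_card_of_injOn (fun i => T i j)
    · intro i
      simp only [Finset.coe_filter, Finset.mem_Ico, Set.mem_ofPred_eq, Finset.coe_Ioc, Set.mem_Ioc]
      exact fun h => h.2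
    · intro i hi i' hi' he
      simp only [Finset.coe_filter, Finset.mem_Ico, Set.mem_ofPred_eq] at hi hi' he
      rcases lt_trichotomy i i' with h | h | h
      · exact absurd he (hT.inj i i' j (by omega) h (by omega) hj (by omega))
      · exact h
      · exact absurd he.symm (hT.inj i' i j (by omega) h (by omega) hj (by omega))
  rw [Nat.card_Ioc] at h₂
  omega

theorem lehmer_add (hT : Tableau n T) {p j : ℕ} (_ : 1 ≤ p) (hpj : p < j) (hj : j ≤ n)
    (h : T p j ≠ 0) : lehmer T p j + 1 + colCount T 1 p j (T p j) = T p j := by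
  have h₁ : (Finset.Ico 1 (T p j)).card = T p j - 1 := by simp
  have h₂ := Finset.card_filter_add_card_filter_not (s := Finset.Ico 1 (T p j))
    (fun k => ∀ i', 1 ≤ i' → i' < p → T i' j ≠ k)
  have h₃ : colCount T 1 p j (T p j) = ((Finset.Ico 1 (T p j)).filter
      (fun k => ¬ ∀ i', 1 ≤ i' → i' < p → T i' j ≠ k)).card := by
    unfold colCount
    apply Finset.card_bij (fun i _ => T i j)
    · intro i
      simp only [Finset.mem_filter, Finset.mem_Ico]
      rintro ⟨⟨h₁, h₂⟩, h₃, h₄⟩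
      have := hT.inj i p j h₁ h₂ hpj hj (by omega)
      refine ⟨by omega, fun hh => hh i h₁ h₂ rfl⟩
    · intro i hi i' hi' he
      simp only [Finset.mem_filter, Finset.mem_Ico] at hi hi'
      rcases lt_trichotomy i i' with h | h | h
      · exact absurd he (hT.inj i i' j (by omega) h (by omega) hj (by omega))
      · exact h
      · exact absurd he.symm (hT.inj i' i j (by omega) h (by omega) hj (by omega))
    · intro k
      simp only [Finset.mem_filter, Finset.mem_Ico]
      rintro ⟨h₁, h₂⟩
      push Not at h₂
      obtain ⟨i, h₃, h₄, h₅⟩ := h₂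
      exact ⟨i, ⟨⟨h₃, h₄⟩, by omega⟩, h₅⟩
  unfold lehmer
  omega

theorem le_iff (hT : Tableau n T) {p j : ℕ} (hp : 1 ≤ p) (hpj : p < j) (hj : j ≤ n)
    (h : T p j ≠ 0) (t : ℕ) : T p j ≤ t ↔ lehmer T p j + 1 + colCount T 1 p j t ≤ t := by
  have h₁ := hT.lehmer_add hp hpj hj h
  constructor
  · intro ht
    have := hT.colCount_le_add_sub hpj.le hj ht
    omega
  · intro h₂
    by_contra hlt
    push Not at hlt
    have h₃ := hT.colCount_le_add_sub (p := p + 1) hpj hj hlt.le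
    rw [colCount_split T j _ hp (Nat.lt_succ_self p), colCount_split T j _ hp (Nat.lt_succ_self p)]
      at h₃
    simp [colCount, show ¬ T p j ≤ t by omega, Nat.pos_of_ne_zero h] at h₃ h₁ h₂
    omega

end Tableau

/-- Two inversions tableaux of the same shape whose Lehmer forms are comparable. -/
structure TableauLE (n : ℕ) (T U : ℕ → ℕ → ℕ) : Prop where
  left : Tableau n T
  right : Tableau n U
  zero : ∀ i j, 1 ≤ i → i < j → j ≤ n → (T i j = 0 ↔ U i j = 0)
  le : ∀ i j, 1 ≤ i → i < j → j ≤ n → T i j ≠ 0 → lehmer T i j ≤ lehmer U i j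

namespace TableauLE

variable {n : ℕ} {T U : ℕ → ℕ → ℕ}

theorem colCount_le (h : TableauLE n T U) {p j : ℕ} (hp : 1 ≤ p) (hpj : p ≤ j) (hj : j ≤ n)
    (t : ℕ) : colCount U 1 p j t ≤ colCount T 1 p j t := by
  induction p, hp using Nat.le_induction with
  | base => simp [colCount]
  | succ p hp ih =>
    have ih := ih (by omega)
    rw [colCount_split U j t hp (Nat.lt_succ_self p), colCount_split T j t hp (Nat.lt_succ_self p)]
    have h₀ : ∀ V, colCount V (p + 1) (p + 1) j t = 0 := by simp [colCount]
    rw [h₀, h₀]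
    have hz := h.zero p j hp (by omega) hj
    by_cases hT : T p j = 0
    · have hU := hz.1 hT
      simp [hT, hU, ih]
    · have h₁ := h.left.le_iff hp (by omega) hj hT t
      have h₂ := h.right.le_iff hp (by omega) hj (by omega) t
      have h₃ := h.le p j hp (by omega) hj hT
      split_ifs <;> omega

/-- If the pairs `(p, q)` and `(p, x)` cross in the same row `a`, the pair `(q, x)` crosses above
row `a`, and `(p, q)` can be raised, then so can `(p, x)`. -/
theorem lehmer_lt_of_right (h : TableauLE n T U) {p q x a : ℕ} (hp : 1 ≤ p) (hpq : p < q)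
    (hqx : q < x) (hx : x ≤ n) (ha : 0 < a) (hTq : T p q = a) (hTx : T p x = a)
    (hqx' : a < T q x) (hlt : lehmer T p q < lehmer U p q)
    (hno : ∀ i, p < i → i < q → T p i = a → 0 < T i x → T i x < a → False) :
    lehmer T p x < lehmer U p x := by
  by_contra hcon
  have heq : lehmer T p x = lehmer U p x :=
    le_antisymm (h.le p x hp (by omega) hx (by omega)) (by omega)
  have zpq := h.zero p q hp hpq (by omega)
  have zpx := h.zero p x hp (by omega) hx
  have zqx := h.zero q x (by omega) hqx hx
  have bpqx := h.left.bal p q x hp hpq hqx hx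
  have bpqx' := h.right.bal p q x hp hpq hqx hx
  have ipqx' := h.right.inj p q x hp hpq hqx hx (by omega)
  have ax := h.left.lehmer_add hp (by omega) hx (p := p) (j := x) (by omega)
  have ax' := h.right.lehmer_add hp (by omega) hx (p := p) (j := x) (by omega)
  have mx := h.colCount_le hp (by omega) hx (p := p) (j := x) a
  have le0 : U p x ≤ a :=
    (h.right.le_iff hp (by omega) hx (by omega) a).2 (by rw [← heq]; rw [hTx] at ax; omega)
  set t := U p x with ht
  -- the counting argument, for a pipe `i` whose column is already large
  have count : ∀ i, p < i → i < x → U p i ≠ 0 → U p i ≤ t → a < T p i ∨ i = q →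
      (i ≠ q → 0 < T i x ∧ T i x < a) →
      ∃ e, 1 ≤ e ∧ e < p ∧
      (if 0 < T e x ∧ T e x ≤ a then 1 else 0) +
        (if 0 < U e i ∧ U e i ≤ t then 1 else 0) <
      (if 0 < U e x ∧ U e x ≤ t then 1 else 0) +
        (if 0 < T e i ∧ T e i ≤ a then 1 else 0) := by
    intro i hpi hix hnz hle hor _
    apply exists_of_colCount_lt
    have e₁ := (h.right.le_iff hp hpi (by omega) hnz t).1 hle
    have e₂ : a ≤ lehmer U p i + colCount T 1 p i a := by
      rcases hor with hor | rfl
      · have e₃ := (h.left.le_iff hp hpi (by omega) (by omega) a).not.1 (by omega)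
        have e₄ := h.le p i hp hpi (by omega) (by omega)
        omega
      · have e₃ := h.left.lehmer_add hp hpi (by omega) (by omega)
        rw [hTq] at e₃
        omega
    rw [hTx] at ax
    omega
  by_cases hcase : t < U q x
  · obtain ⟨e, he1, hep, hlt⟩ := count q hpq hqx (by omega) (by omega) (Or.inr rfl) (by simp)
    have b₁ := h.left.bal e p q he1 hep hpq (by omega)
    have b₂ := h.left.bal e p x he1 hep (by omega) hx
    have b₃ := h.left.bal e q x he1 (by omega) hqx hx
    have b₄ := h.right.bal e q x he1 (by omega) hqx hx
    have z₁ := h.zero e q he1 (by omega) (by omega)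
    have z₂ := h.zero e x he1 (by omega) hx
    have i₁ := h.left.inj e p x he1 hep (by omega) hx
    have i₂ := h.left.inj e p q he1 hep (by omega) (by omega)
    split_ifs at hlt <;> omega
  · -- now `U q x < t`
    have hu : U q x < t := by omega
    have G : ∀ i, p < i → i < q → 0 < T i x → T i x ≤ a → U i x ≤ t := by
      intro i hpi hiq h₁ h₂
      have b₀ := h.left.bal p i x hp hpi (by omega) hx
      have b₀' := h.right.bal p i x hp hpi (by omega) hx
      have i₀ := h.left.inj p i x hp hpi (by omega) hx (by omega)
      have n₀ := hno i hpi hiq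
      have z₀ := h.zero p i hp hpi (by omega)
      have z₁ := h.zero i x (by omega) (by omega) hx
      have hTi : a < T p i := by
        rcases lt_trichotomy (T p i) a with h₃ | h₃ | h₃
        · omega
        · exact (n₀ h₃ h₁ (by omega)).elim
        · exact h₃
      by_contra hgt
      obtain ⟨e, he1, hep, hlt⟩ := count i hpi (by omega) (by omega) (by omega) (Or.inl hTi)
        (fun _ => ⟨h₁, by omega⟩)
      have b₁ := h.left.bal e p i he1 hep hpi (by omega)
      have b₂ := h.left.bal e p x he1 hep (by omega) hx
      have b₃ := h.left.bal e i x he1 (by omega) (by omega) hx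
      have b₄ := h.right.bal e i x he1 (by omega) (by omega) hx
      have z₁ := h.zero e i he1 (by omega) (by omega)
      have z₂ := h.zero e x he1 (by omega) hx
      have i₁ := h.left.inj e p x he1 hep (by omega) hx
      have i₂ := h.left.inj e p i he1 hep (by omega) (by omega)
      split_ifs at hlt <;> omega
    have s₁ := colCount_split T x a hp hpq
    have s₂ := colCount_split U x t hp hpq
    have s₃ := colCount_split U x (U q x) hp hpq
    have m₁ := h.right.colCount_le_add_sub (p := q) (j := x) hqx.le hx hu.le
    have l₁ := (h.left.le_iff (p := q) (j := x) (by omega) hqx hx (by omega) a).not.1 (by omega)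
    have l₂ := h.right.lehmer_add (p := q) (j := x) (by omega) hqx hx (by omega)
    have l₃ := h.le q x (by omega) hqx hx (by omega)
    have m₂ : colCount T (p + 1) q x a ≤ colCount U (p + 1) q x t :=
      colCount_le_of_imp fun i h₁ h₂ h₃ h₄ =>
        ⟨Nat.pos_of_ne_zero fun h₀ => h₃.ne' ((h.zero i x (by omega) (by omega) hx).2 h₀),
          G i h₁ h₂ h₃ h₄⟩
    rw [if_pos ⟨by omega, by omega⟩] at s₁
    rw [if_pos ⟨by omega, by omega⟩] at s₂
    rw [if_neg (by omega)] at s₃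
    rw [hTx] at ax
    omega

/-- If `(i, q)` crosses above row `a = T p q`, the pair `(p, q)` can be raised and `(p, i)` cannot,
then `(i, q)` stays above `(p, q)` in `U`. -/
theorem lt_of_saturated (h : TableauLE n T U) {p q i a : ℕ} (hp : 1 ≤ p) (hpi : p < i)
    (hiq : i < q) (hq : q ≤ n) (ha : 0 < a) (hTq : T p q = a) (hTi : a < T i q)
    (hlt : lehmer T p q < lehmer U p q)
    (hor : T p i ≠ 0 → T p i ≤ a ∧ lehmer T p i = lehmer U p i) :
    U p q < U i q := by
  have zpi := h.zero p i hp hpi (by omega)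
  have zpq := h.zero p q hp (by omega) hq
  have ziq := h.zero i q (by omega) hiq hq
  have b := h.right.bal p i q hp hpi hiq hq
  have b' := h.left.bal p i q hp hpi hiq hq
  have inj := h.right.inj p i q hp hpi hiq hq (by omega)
  by_contra hcon
  have hnz : T p i ≠ 0 := by omega
  obtain ⟨h₁, h₂⟩ := hor hnz
  set u := U p q with hu
  have e₁ := h.right.lehmer_add (p := p) (j := q) hp (by omega) hq (by omega)
  have e₂ := h.left.lehmer_add (p := p) (j := q) hp (by omega) hq (by omega)
  have e₃ : u ≤ lehmer U p i + 1 + colCount U 1 p i u := by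
    by_cases hle : U p i ≤ u
    · have e₄ : U p i = u := by omega
      have e₅ := h.right.lehmer_add (p := p) (j := i) hp (by omega) (by omega) (by omega)
      rw [e₄] at e₅
      omega
    · have e₄ := (h.right.le_iff (p := p) (j := i) hp hpi (by omega) (by omega) u).not.1 hle
      omega
  have e₄ := (h.left.le_iff hp hpi (by omega) hnz a).1 h₁
  rw [hTq] at e₂
  rw [← hu] at e₁
  obtain ⟨e, he1, hep, hlt⟩ := exists_of_colCount_lt (T₁ := U) (T₂ := T) (T₃ := T) (T₄ := U)
    (p := p) (j₁ := q) (j₂ := i) (j₃ := q) (j₄ := i) (t₁ := u) (t₂ := a) (t₃ := a) (t₄ := u)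
    (by omega)
  have b₁ := h.left.bal e i q he1 (by omega) hiq hq
  have b₂ := h.right.bal e i q he1 (by omega) hiq hq
  have z₁ := h.zero e i he1 (by omega) (by omega)
  have z₂ := h.zero e q he1 (by omega) hq
  split_ifs at hlt <;> omega

/-- Lower bound for a Lehmer entry above a raised one, counting the intermediate entries. -/
theorem le_lehmer_of_lt (h : TableauLE n T U) {p q z a : ℕ} (hp : 1 ≤ p) (hpz : p < z)
    (hzq : z < q) (hq : q ≤ n) (ha : 0 < a) (hTq : T p q = a)
    (hlt : lehmer T p q < lehmer U p q) (hz : U p q < U z q)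
    (hor : ∀ i, p < i → i < z → a < T i q → T p i ≠ 0 →
      T p i ≤ a ∧ lehmer T p i = lehmer U p i) :
    a ≤ lehmer U z q + colCount T 1 p q a + colCount T (p + 1) z q a := by
  have zpq := h.zero p q hp (by omega) hq
  have e₁ := h.right.lehmer_add (p := p) (j := q) hp (by omega) hq (by omega)
  have e₂ := h.left.lehmer_add (p := p) (j := q) hp (by omega) hq (by omega)
  have e₃ := (h.right.le_iff (p := z) (j := q) (by omega) hzq hq (by omega) (U p q)).not.1 (by omega)
  have s := colCount_split U q (U p q) hp hpz
  rw [if_pos ⟨by omega, by omega⟩] at s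
  have m : colCount U (p + 1) z q (U p q) ≤ colCount T (p + 1) z q a := by
    apply colCount_le_of_imp
    intro i h₁ h₂ h₃ h₄
    have zi := h.zero i q (by omega) (by omega) hq
    refine ⟨by omega, ?_⟩
    by_contra h₅
    have := h.lt_of_saturated hp h₁ (by omega) hq ha hTq (by omega) hlt
      (hor i h₁ h₂ (by omega))
    omega
  rw [hTq] at e₂
  omega

/-- A pair `(p, x)` crossing in the same row as a raised pair `(p, q)` with `x < q` can itself be
raised. -/
theorem lehmer_lt_of_left (h : TableauLE n T U) {p q x a : ℕ} (hp : 1 ≤ p) (hpx : p < x)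
    (hxq : x < q) (hq : q ≤ n) (ha : 0 < a) (hTq : T p q = a) (hTx : T p x = a)
    (hxq' : T x q < a) (hlt : lehmer T p q < lehmer U p q)
    (heqx : T x q ≠ 0 → lehmer T x q = lehmer U x q)
    (hor : ∀ i, p < i → i < x → a < T i q → T p i ≠ 0 →
      T p i ≤ a ∧ lehmer T p i = lehmer U p i) :
    lehmer T p x < lehmer U p x := by
  by_contra hcon
  have heq : lehmer T p x = lehmer U p x :=
    le_antisymm (h.le p x hp (by omega) (by omega) (by omega)) (by omega)
  have zpq := h.zero p q hp (by omega) (by omega)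
  have zpx := h.zero p x hp (by omega) (by omega)
  have zxq := h.zero x q (by omega) hxq hq
  have bU := h.right.bal p x q hp hpx hxq hq
  have iU := h.right.inj p x q hp hpx hxq hq (by omega)
  have a₁ := h.left.lehmer_add hp (by omega) (by omega) (p := p) (j := x) (by omega)
  have a₂ := h.right.lehmer_add hp (by omega) (by omega) (p := p) (j := x) (by omega)
  have a₃ := h.left.lehmer_add hp (by omega) (by omega) (p := p) (j := q) (by omega)
  rw [hTx] at a₁
  rw [hTq] at a₃
  have key : U p q ≤ U p x → T x q ≠ 0 ∧ U p q < U x q := by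
    intro hle
    have e₁ := (h.right.le_iff (p := p) (j := q) hp (by omega) hq (by omega) (U p x)).1 hle
    obtain ⟨e, he1, hep, hlt⟩ := exists_of_colCount_lt (T₁ := T) (T₂ := U) (T₃ := U) (T₄ := T)
      (p := p) (j₁ := x) (j₂ := q) (j₃ := x) (j₄ := q) (t₁ := a) (t₂ := U p x) (t₃ := U p x)
      (t₄ := a) (by omega)
    have b₁ := h.left.bal e p q he1 hep (by omega) hq
    have b₂ := h.left.bal e p x he1 hep (by omega) (by omega)
    have b₃ := h.left.bal e x q he1 (by omega) hxq hq
    have b₄ := h.right.bal e x q he1 (by omega) hxq hq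
    have z₁ := h.zero e q he1 (by omega) (by omega)
    have z₂ := h.zero e x he1 (by omega) (by omega)
    have i₁ := h.left.inj e p x he1 hep (by omega) (by omega)
    have i₂ := h.left.inj e p q he1 hep (by omega) (by omega)
    split_ifs at hlt <;> omega
  have hnz : T x q ≠ 0 := by
    by_contra h₀
    have := key (by omega)
    omega
  have hgt : U p q < U x q := by
    by_cases hle : U p q ≤ U p x
    · exact (key hle).2
    · omega
  have lb := h.le_lehmer_of_lt hp hpx hxq hq ha hTq hlt hgt hor
  have e₁ := h.left.lehmer_add (p := x) (j := q) (by omega) hxq hq hnz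
  have e₂ := heqx hnz
  have m := h.left.colCount_le_add_sub (p := x) (j := q) hxq.le hq hxq'.le
  have s₁ := colCount_split T q a hp hpx
  rw [if_pos ⟨by omega, by omega⟩] at s₁
  omega

/-- Column `q`, filled between rows `a` and `b`, cannot be blocked by a saturated pair `(z, q)`
with `p < z`. -/
theorem false_of_blocked_right (h : TableauLE n T U) {p q z a b : ℕ} (hp : 1 ≤ p) (hpz : p < z)
    (hzq : z < q) (hq : q ≤ n) (ha : 0 < a) (hab : a < b) (hTq : T p q = a) (hTz : T z q = b)
    (hlt : lehmer T p q < lehmer U p q) (heq : lehmer T z q = lehmer U z q)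
    (hfull : ∀ r, a < r → r < b → ∃ y, 1 ≤ y ∧ y < p ∧ T y q = r)
    (hor : ∀ i, p < i → i ≤ z → a < T i q → T p i ≠ 0 →
      T p i ≤ a ∧ lehmer T p i = lehmer U p i) : False := by
  have hgt := h.lt_of_saturated hp hpz hzq hq ha hTq (by omega) hlt (hor z hpz le_rfl (by omega))
  have lb := h.le_lehmer_of_lt hp hpz hzq hq ha hTq hlt hgt
    fun i h₁ h₂ => hor i h₁ h₂.le
  have e₁ := h.left.lehmer_add (p := z) (j := q) (by omega) hzq hq (by omega)
  have f := le_colCount_of_full (T := T) (p := p) (j := q) (s := a) (t := b - 1) (by omega)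
    fun r h₁ h₂ => hfull r h₁ (by omega)
  have f₂ : colCount T 1 p q (b - 1) ≤ colCount T 1 p q b :=
    colCount_le_of_imp fun i _ _ h₁ h₂ => ⟨h₁, by omega⟩
  have f₃ : colCount T (p + 1) z q a ≤ colCount T (p + 1) z q b :=
    colCount_le_of_imp fun i _ _ h₁ h₂ => ⟨h₁, by omega⟩
  have s := colCount_split T q b hp hpz
  rw [if_pos ⟨by omega, by omega⟩] at s
  rw [hTz] at e₁
  omega

/-- Column `q`, filled between rows `a` and `b`, cannot be blocked by a saturated pair `(z, q)`
with `z < p`. -/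
theorem false_of_blocked_left (h : TableauLE n T U) {p q z a b : ℕ} (hz : 1 ≤ z) (hzp : z < p)
    (hpq : p < q) (hq : q ≤ n) (ha : 0 < a) (hab : a < b) (hTq : T p q = a) (hTz : T z q = b)
    (hTzp : b < T z p)
    (hlt : lehmer T p q < lehmer U p q) (heq : lehmer T z q = lehmer U z q)
    (hfull : ∀ r, a < r → r < b → ∃ y, 1 ≤ y ∧ y < p ∧ T y q = r)
    (hno : ∀ i, z < i → i < p → T z i = b → 0 < T i q → T i q < b → False) : False := by
  have zzq := h.zero z q hz (by omega) hq
  have zpq := h.zero p q (by omega) hpq hq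
  have l₁ := h.left.lehmer_add (p := z) (j := q) hz (by omega) hq (by omega)
  have l₂ := h.right.lehmer_add (p := z) (j := q) hz (by omega) hq (by omega)
  have l₃ := h.left.lehmer_add (p := p) (j := q) (by omega) hpq hq (by omega)
  have l₄ := h.right.lehmer_add (p := p) (j := q) (by omega) hpq hq (by omega)
  rw [hTz] at l₁
  rw [hTq] at l₃
  have le0 : U z q ≤ b :=
    (h.right.le_iff hz (by omega) hq (by omega) b).2
      (by have := h.colCount_le (p := z) (j := q) hz (by omega) hq b; omega)
  have sub : ∀ i, z < i → i < q → b < T z i → 0 < T i q → T i q ≤ b → U i q ≤ U z q := by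
    intro i hzi hiq h₁ h₂ h₃
    by_contra hgt
    have b₀ := h.right.bal z i q hz hzi hiq hq
    have z₀ := h.zero z i hz hzi (by omega)
    have i₀ := h.right.inj z i q hz hzi hiq hq (by omega)
    have e₁ := (h.right.le_iff (p := z) (j := i) hz hzi (by omega) (by omega) (U z q)).1 (by omega)
    have e₂ := h.le z i hz hzi (by omega) (by omega)
    have e₃ := (h.left.le_iff (p := z) (j := i) hz hzi (by omega) (by omega) b).not.1 (by omega)
    obtain ⟨e, he1, hep, hlt⟩ := exists_of_colCount_lt (T₁ := T) (T₂ := U) (T₃ := U) (T₄ := T)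
      (p := z) (j₁ := q) (j₂ := i) (j₃ := q) (j₄ := i) (t₁ := b) (t₂ := U z q) (t₃ := U z q)
      (t₄ := b) (by omega)
    have b₁ := h.left.bal e i q he1 (by omega) hiq hq
    have b₂ := h.right.bal e i q he1 (by omega) hiq hq
    have z₁ := h.zero e i he1 (by omega) (by omega)
    have z₂ := h.zero e q he1 (by omega) hq
    split_ifs at hlt <;> omega
  have hpz := sub p hzp hpq hTzp (by omega) (by omega)
  have iU := h.right.inj z p q hz hzp hpq hq (by omega)
  have m : colCount T (z + 1) p q b ≤ colCount U (z + 1) p q (U z q) := by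
    apply colCount_le_of_imp
    intro i h₁ h₂ h₃ h₄
    have zi := h.zero i q (by omega) (by omega) hq
    refine ⟨by omega, ?_⟩
    have b₀ := h.left.bal z i q hz (by omega) (by omega) hq
    have i₀ := h.left.inj z i q hz (by omega) (by omega) hq (by omega)
    have n₀ := hno i h₁ h₂
    rcases lt_trichotomy (T z i) b with h₅ | h₅ | h₅
    · omega
    · exact (n₀ h₅ h₃ (by omega)).elim
    · exact sub i h₁ (by omega) h₅ h₃ h₄
  have f := le_colCount_of_full (T := T) (p := p) (j := q) (s := a) (t := b) hab.le
    fun r h₁ h₂ => by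
      by_cases hr : r = b
      · exact ⟨z, hz, hzp, by omega⟩
      · exact hfull r h₁ (by omega)
  have mm := h.right.colCount_le_add_sub (p := p) (j := q) hpq.le hq hpz
  have s₁ := colCount_split T q b hz hzp
  have s₂ := colCount_split U q (U z q) hz hzp
  rw [if_pos ⟨by omega, by omega⟩] at s₁ s₂
  omega

end TableauLE

/-- All crosses of `P` lie in the staircase. -/
def InStaircase (n : ℕ) (P : ℕ → ℕ → Bool) : Prop :=
  ∀ i j, P i j = true → 1 ≤ i ∧ 1 ≤ j ∧ i + j ≤ n

/-- The word of pipes met after reading rows `n, …, r + 1` and then the first `j` boxes of row `r`,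
each from left to right. -/
def pipeWord (n : ℕ) (P : ℕ → ℕ → Bool) (r : ℕ) : ℕ → Equiv.Perm ℕ
  | 0 => if n ≤ r then 1 else pipeWord n P (r + 1) (n - (r + 1))
  | j + 1 => if P r (j + 1) then pipeWord n P r j * Equiv.swap (r + j) (r + j + 1)
      else pipeWord n P r j
termination_by j => (n - r, j)

/-- The position of pipe `p` in `pipeWord n P r j`. -/
def pipePos (n : ℕ) (P : ℕ → ℕ → Bool) (r j p : ℕ) : ℕ := (pipeWord n P r j).symm p

section Words

variable {n : ℕ} {P : ℕ → ℕ → Bool}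

theorem pipeWord_zero {r : ℕ} (h : r < n) :
    pipeWord n P r 0 = pipeWord n P (r + 1) (n - (r + 1)) := by
  rw [pipeWord, if_neg (by omega)]

theorem pipeWord_zero_of_le {r : ℕ} (h : n ≤ r) : pipeWord n P r 0 = 1 := by
  rw [pipeWord, if_pos h]

theorem pipeWord_succ_true {r j : ℕ} (h : P r (j + 1) = true) :
    pipeWord n P r (j + 1) = pipeWord n P r j * Equiv.swap (r + j) (r + j + 1) := by
  rw [pipeWord, if_pos h]

theorem pipeWord_succ_false {r j : ℕ} (h : P r (j + 1) = false) :
    pipeWord n P r (j + 1) = pipeWord n P r j := by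
  rw [pipeWord, if_neg (by simp [h])]

/-- Induction along the reading order of the boxes. -/
theorem reading_induction (n : ℕ) {C : ℕ → ℕ → Prop} (h₀ : ∀ r, n ≤ r → C r 0)
    (h₁ : ∀ r, r < n → C (r + 1) (n - (r + 1)) → C r 0) (h₂ : ∀ r j, C r j → C r (j + 1)) :
    ∀ r j, C r j := by
  have : ∀ m r, n - r ≤ m → ∀ j, C r j := by
    intro m
    induction m with
    | zero =>
      intro r hr j
      induction j with
      | zero => exact h₀ r (by omega)
      | succ j ih => exact h₂ r j ih
    | succ m ihm =>
      intro r hr j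
      induction j with
      | zero =>
        by_cases h : n ≤ r
        · exact h₀ r h
        · exact h₁ r (by omega) (ihm _ (by omega) _)
      | succ j ih => exact h₂ r j ih
  exact fun r j => this _ r le_rfl j

theorem pipeWord_fix (hP : InStaircase n P) (r j : ℕ) :
    ∀ k, k < r ∨ n < k → pipeWord n P r j k = k := by
  refine reading_induction n (C := fun r j => ∀ k, k < r ∨ n < k → pipeWord n P r j k = k)
    ?_ ?_ ?_ r j
  · intro r hr k _
    rw [pipeWord_zero_of_le hr]; rfl
  · intro r hr ih k hk
    rw [pipeWord_zero hr]
    exact ih k (by omega)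
  · intro r j ih k hk
    cases h : P r (j + 1) with
    | false => rw [pipeWord_succ_false h]; exact ih k hk
    | true =>
      have := hP _ _ h
      rw [pipeWord_succ_true h, Equiv.Perm.mul_apply,
        Equiv.swap_apply_of_ne_of_ne (by omega) (by omega)]
      exact ih k hk

theorem pipePos_fix (hP : InStaircase n P) (r j : ℕ) {k : ℕ} (hk : k < r ∨ n < k) :
    pipePos n P r j k = k := by
  unfold pipePos
  rw [Equiv.symm_apply_eq, pipeWord_fix hP r j k hk]

theorem pipePos_mem (hP : InStaircase n P) (r j : ℕ) {k : ℕ} (hk : r ≤ k ∧ k ≤ n) :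
    r ≤ pipePos n P r j k ∧ pipePos n P r j k ≤ n := by
  by_contra h
  have h₁ := pipeWord_fix hP r j (pipePos n P r j k) (by omega)
  have h₂ : pipeWord n P r j (pipePos n P r j k) = k := Equiv.apply_symm_apply _ _
  omega

theorem pipeWord_eq_iff {r j k p : ℕ} : pipeWord n P r j k = p ↔ pipePos n P r j p = k := by
  unfold pipePos
  rw [Equiv.symm_apply_eq]
  exact eq_comm

theorem pipePos_injective (r j : ℕ) : Function.Injective (pipePos n P r j) :=
  (pipeWord n P r j).symm.injective

theorem northLabel_true {i j : ℕ} (hP : InStaircase n P) (h : P i j = true) :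
    northLabel n P i j = southLabel n P i j := by
  have := hP _ _ h
  unfold northLabel southLabel
  rw [labels]
  rw [dif_pos (by omega), if_pos h]

theorem northLabel_false {i j : ℕ} (h : P i j = false) :
    northLabel n P i j = westLabel n P i j := by
  unfold northLabel westLabel
  rw [labels]
  split_ifs <;> simp_all

theorem westLabel_one (i : ℕ) : westLabel n P i 1 = i := by
  simp [westLabel]

theorem westLabel_true {i j : ℕ} (hP : InStaircase n P) (h : P i j = true) :
    westLabel n P i (j + 1) = westLabel n P i j := by
  have := hP _ _ h
  rw [westLabel, if_neg (by omega), Nat.add_sub_cancel, labels]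
  rw [dif_pos (by omega), if_pos h]
  simp [westLabel]

theorem westLabel_false {i j : ℕ} (hj : 1 ≤ j) (hij : i + j ≤ n) (h : P i j = false) :
    westLabel n P i (j + 1) = southLabel n P i j := by
  rw [westLabel, if_neg (by omega), Nat.add_sub_cancel, labels]
  rw [dif_pos (by omega), if_neg (by simp [h])]
  rfl

theorem label_eq (hP : InStaircase n P) (r j : ℕ) : r + j ≤ n →
    westLabel n P r (j + 1) = pipeWord n P r j (r + j) ∧
    (∀ k, 1 ≤ k → k ≤ j → northLabel n P r k = pipeWord n P r j (r + k - 1)) ∧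
    (∀ k, j < k → r + k ≤ n → southLabel n P r k = pipeWord n P r j (r + k)) := by
  refine reading_induction n (C := fun r j => r + j ≤ n →
    westLabel n P r (j + 1) = pipeWord n P r j (r + j) ∧
    (∀ k, 1 ≤ k → k ≤ j → northLabel n P r k = pipeWord n P r j (r + k - 1)) ∧
    (∀ k, j < k → r + k ≤ n → southLabel n P r k = pipeWord n P r j (r + k))) ?_ ?_ ?_ r j
  · intro r hr h
    rw [pipeWord_zero_of_le hr, westLabel_one]
    refine ⟨rfl, fun k h₁ h₂ => by omega, fun k h₁ h₂ => by omega⟩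
  · intro r hr ih _
    obtain ⟨h₁, h₂, -⟩ := ih (by omega)
    rw [pipeWord_zero hr, westLabel_one]
    refine ⟨(pipeWord_fix hP _ _ _ (by omega)).symm, fun k h₁ h₂ => by omega, fun k h₃ h₄ => ?_⟩
    by_cases hk : k ≤ n - (r + 1)
    · exact (h₂ k h₃ hk).trans (by congr 1; omega)
    · have hf : P (r + 1) k = false := by
        by_contra hc
        have := hP (r + 1) k (by simpa using hc)
        omega
      have hk' : k = n - (r + 1) + 1 := by omega
      have : southLabel n P r k = westLabel n P (r + 1) k := northLabel_false hf
      rw [this, hk', h₁]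
      congr 1
      omega
  · intro r j ih h
    obtain ⟨h₁, h₂, h₃⟩ := ih (by omega)
    have h₄ := h₃ (j + 1) (by omega) (by omega)
    cases hp : P r (j + 1) with
    | false =>
      rw [pipeWord_succ_false hp, westLabel_false (by omega) (by omega) hp]
      refine ⟨h₄, fun k h₅ h₆ => ?_, fun k h₅ h₆ => h₃ k (by omega) h₆⟩
      by_cases hk : k ≤ j
      · exact h₂ k h₅ hk
      · have : k = j + 1 := by omega
        subst this
        rw [northLabel_false hp, h₁]; rfl
    | true =>
      rw [pipeWord_succ_true hp, westLabel_true hP hp]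
      refine ⟨?_, fun k h₅ h₆ => ?_, fun k h₅ h₆ => ?_⟩
      · rw [h₁, Equiv.Perm.mul_apply, ← add_assoc, Equiv.swap_apply_right]
      · by_cases hk : k ≤ j
        · rw [Equiv.Perm.mul_apply, Equiv.swap_apply_of_ne_of_ne (by omega) (by omega)]
          exact h₂ k h₅ hk
        · have : k = j + 1 := by omega
          subst this
          rw [northLabel_true hP hp, h₄, Equiv.Perm.mul_apply,
            show r + (j + 1) - 1 = r + j by omega, Equiv.swap_apply_left]
          rfl
      · rw [Equiv.Perm.mul_apply, Equiv.swap_apply_of_ne_of_ne (by omega) (by omega)]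
        exact h₃ k (by omega) h₆

theorem westLabel_eq_iff (hP : InStaircase n P) {r j p : ℕ} (h : r + j ≤ n) :
    westLabel n P r (j + 1) = p ↔ pipePos n P r j p = r + j := by
  rw [(label_eq hP r j h).1, pipeWord_eq_iff]

theorem southLabel_eq_iff (hP : InStaircase n P) {r j k p : ℕ} (h : j < k) (hk : r + k ≤ n) :
    southLabel n P r k = p ↔ pipePos n P r j p = r + k := by
  rw [(label_eq hP r j (by omega)).2.2 k h hk, pipeWord_eq_iff]

theorem northLabel_eq_iff (hP : InStaircase n P) {r k p : ℕ} (h₁ : 1 ≤ k) (h₂ : r + k ≤ n + 1) :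
    northLabel n P r k = p ↔ pipePos n P r (n - r) p = r + k - 1 := by
  by_cases h : r + k ≤ n
  · rw [(label_eq hP r (n - r) (by omega)).2.1 k h₁ (by omega), pipeWord_eq_iff]
  · have hf : P r k = false := by
      by_contra hc
      have := hP r k (by simpa using hc)
      omega
    rw [northLabel_false hf, show k = n - r + 1 by omega, westLabel_eq_iff hP (by omega)]
    omega

/-- One step of the reading word. -/
theorem pipePos_succ (r j p : ℕ) : pipePos n P r (j + 1) p =
    if P r (j + 1) = true ∧ pipePos n P r j p = r + j then r + j + 1
    else if P r (j + 1) = true ∧ pipePos n P r j p = r + j + 1 then r + j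
    else pipePos n P r j p := by
  cases h : P r (j + 1) with
  | false => simp [pipePos, pipeWord_succ_false h]
  | true =>
    have : pipePos n P r (j + 1) p = Equiv.swap (r + j) (r + j + 1) (pipePos n P r j p) := by
      unfold pipePos
      rw [pipeWord_succ_true h]
      rfl
    rw [this, Equiv.swap_apply_def]
    simp

theorem pipePos_zero {r : ℕ} (h : r < n) (p : ℕ) :
    pipePos n P r 0 p = pipePos n P (r + 1) (n - (r + 1)) p := by
  unfold pipePos
  rw [pipeWord_zero h]

theorem pipePos_of_lt {r j p : ℕ} (h : pipePos n P r j p < r + j) {k : ℕ} (hk : j ≤ k) :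
    pipePos n P r k p = pipePos n P r j p := by
  induction k, hk using Nat.le_induction with
  | base => rfl
  | succ k hk ih => rw [pipePos_succ, ih, if_neg (by omega), if_neg (by omega)]

end Words

section Reduced

variable {n : ℕ} {P : ℕ → ℕ → Bool}

theorem crossAt_comm {r j p q : ℕ} : CrossAt n P r j p q ↔ CrossAt n P r j q p := by
  unfold CrossAt
  rw [or_comm]

theorem crossAt_iff (hP : InStaircase n P) {r j p q : ℕ} :
    CrossAt n P r (j + 1) p q ↔ P r (j + 1) = true ∧
      ((pipePos n P r j p = r + j ∧ pipePos n P r j q = r + j + 1) ∨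
        (pipePos n P r j q = r + j ∧ pipePos n P r j p = r + j + 1)) := by
  unfold CrossAt
  constructor
  · rintro ⟨h₁, h₂, h₃, h₄, h₅⟩
    rw [westLabel_eq_iff hP (by omega), westLabel_eq_iff hP (by omega),
      southLabel_eq_iff hP (Nat.lt_succ_self j) h₃, southLabel_eq_iff hP (Nat.lt_succ_self j) h₃]
      at h₅
    exact ⟨h₄, h₅⟩
  · rintro ⟨h₄, h₅⟩
    obtain ⟨h₁, h₂, h₃⟩ := hP _ _ h₄
    refine ⟨h₁, h₂, h₃, h₄, ?_⟩
    rw [westLabel_eq_iff hP (by omega), westLabel_eq_iff hP (by omega),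
      southLabel_eq_iff hP (Nat.lt_succ_self j) h₃, southLabel_eq_iff hP (Nat.lt_succ_self j) h₃]
    exact h₅

theorem pipePos_lt_iff (hP : InStaircase n P) (hR : Reduced n P) {p s : ℕ} (hps : p < s)
    (r j : ℕ) : pipePos n P r j s < pipePos n P r j p ↔
      ∃ r' j', CrossAt n P r' j' p s ∧ (r < r' ∨ r' = r ∧ j' ≤ j) := by
  refine reading_induction n (C := fun r j => pipePos n P r j s < pipePos n P r j p ↔
      ∃ r' j', CrossAt n P r' j' p s ∧ (r < r' ∨ r' = r ∧ j' ≤ j)) ?_ ?_ ?_ r j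
  · intro r hr
    have h : ∀ k, pipePos n P r 0 k = k := by
      intro k
      unfold pipePos
      rw [pipeWord_zero_of_le hr]; rfl
    rw [h, h]
    constructor
    · intro; omega
    · rintro ⟨r', j', ⟨h₁, h₂, h₃, -⟩, h₄⟩
      omega
  · intro r hr ih
    rw [pipePos_zero hr, pipePos_zero hr, ih]
    constructor
    · rintro ⟨r', j', h₁, h₂⟩
      exact ⟨r', j', h₁, by omega⟩
    · rintro ⟨r', j', h₁, h₂⟩
      refine ⟨r', j', h₁, ?_⟩
      obtain ⟨h₃, h₄, h₅, -⟩ := h₁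
      omega
  · intro r j ih
    have inj := (pipePos_injective (n := n) (P := P) r j).ne hps.ne
    by_cases hc : CrossAt n P r (j + 1) p s
    · have h₁ : ¬ pipePos n P r j s < pipePos n P r j p := by
        rw [ih]
        rintro ⟨r', j', h₁, h₂⟩
        have := hR _ _ _ _ _ _ hc h₁
        omega
      have hc' := (crossAt_iff hP).1 hc
      constructor
      · intro _
        exact ⟨r, j + 1, hc, Or.inr ⟨rfl, le_rfl⟩⟩
      · intro _
        rw [pipePos_succ, pipePos_succ]
        simp only [hc'.1, true_and]
        split_ifs <;> omega
    · have h₁ : pipePos n P r (j + 1) s < pipePos n P r (j + 1) p ↔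
          pipePos n P r j s < pipePos n P r j p := by
        rw [crossAt_iff hP] at hc
        rw [pipePos_succ, pipePos_succ]
        by_cases hb : P r (j + 1) = true
        · simp only [hb, true_and] at hc ⊢
          split_ifs <;> omega
        · simp [hb]
      rw [h₁, ih]
      constructor
      · rintro ⟨r', j', h₁, h₂⟩
        exact ⟨r', j', h₁, by omega⟩
      · rintro ⟨r', j', h₁, h₂⟩
        refine ⟨r', j', h₁, ?_⟩
        by_contra h₃
        obtain ⟨rfl, rfl⟩ : r' = r ∧ j' = j + 1 := by omega
        exact hc h₁

theorem theta_eq (hR : Reduced n P) {r j p q : ℕ} (h : CrossAt n P r j p q) :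
    theta n P p q = r := by
  have he : ∃ rc : ℕ × ℕ, CrossAt n P rc.1 rc.2 p q := ⟨(r, j), h⟩
  unfold theta
  rw [dif_pos he]
  exact (hR _ _ _ _ _ _ (Classical.choose_spec he) h).1

theorem exists_crossAt {p q : ℕ} (h : theta n P p q ≠ 0) :
    ∃ j, CrossAt n P (theta n P p q) j p q := by
  unfold theta at h ⊢
  split_ifs at h ⊢ with he
  · exact ⟨_, Classical.choose_spec he⟩
  · exact absurd rfl h

theorem theta_comm (hR : Reduced n P) (p q : ℕ) : theta n P p q = theta n P q p := by
  by_cases h : theta n P p q = 0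
  · by_cases h' : theta n P q p = 0
    · rw [h, h']
    · obtain ⟨j, hj⟩ := exists_crossAt h'
      exact theta_eq hR (crossAt_comm.1 hj)
  · obtain ⟨j, hj⟩ := exists_crossAt h
    exact (theta_eq hR (crossAt_comm.1 hj)).symm

theorem le_theta_of_pipePos_lt (hP : InStaircase n P) (hR : Reduced n P) {p s : ℕ} (hps : p < s)
    {r j : ℕ} (h : pipePos n P r j s < pipePos n P r j p) : r ≤ theta n P p s := by
  obtain ⟨r', j', h₁, h₂⟩ := (pipePos_lt_iff hP hR hps r j).1 h
  rw [theta_eq hR h₁]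
  omega

theorem le_theta_iff (hP : InStaircase n P) (hR : Reduced n P) {p s : ℕ} (hps : p < s)
    {r : ℕ} (hr : 1 ≤ r) :
    r ≤ theta n P p s ↔ pipePos n P r (n - r) s < pipePos n P r (n - r) p := by
  refine ⟨fun h => ?_, le_theta_of_pipePos_lt hP hR hps⟩
  rw [pipePos_lt_iff hP hR hps]
  obtain ⟨j, hj⟩ := exists_crossAt (n := n) (P := P) (p := p) (q := s) (by omega)
  have := hj.2.2.1
  exact ⟨_, j, hj, by omega⟩

theorem theta_eq_iff (hP : InStaircase n P) (hR : Reduced n P) {r j p q : ℕ} (hr : 1 ≤ r)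
    (hp : pipePos n P r j p = r + j) (hq : pipePos n P r j q = r + j + 1) :
    theta n P p q = r ↔ P r (j + 1) = true := by
  constructor
  · intro h
    obtain ⟨k, hk⟩ := exists_crossAt (n := n) (P := P) (p := p) (q := q) (by omega)
    rw [h] at hk
    obtain ⟨k, rfl⟩ : ∃ k', k = k' + 1 := ⟨k - 1, by have := hk.2.1; omega⟩
    rw [crossAt_iff hP] at hk
    have sp := pipePos_succ (n := n) (P := P) r k p
    have sq := pipePos_succ (n := n) (P := P) r k q
    simp only [hk.1, true_and] at sp sq
    rcases lt_trichotomy k j with hlt | rfl | hlt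
    · obtain ⟨-, ⟨h₁, h₂⟩ | ⟨h₁, h₂⟩⟩ := hk
      · rw [if_neg (by omega), if_pos h₂] at sq
        have := pipePos_of_lt (n := n) (P := P) (r := r) (j := k + 1) (by omega) (show k + 1 ≤ j by omega) (p := q)
        omega
      · rw [if_neg (by omega), if_pos h₂] at sp
        have := pipePos_of_lt (n := n) (P := P) (r := r) (j := k + 1) (by omega) (show k + 1 ≤ j by omega) (p := p)
        omega
    · exact hk.1
    · by_contra hb
      have sp' := pipePos_succ (n := n) (P := P) r j p
      simp only [hb, false_and, if_false] at sp'
      have := pipePos_of_lt (n := n) (P := P) (r := r) (j := j + 1) (by omega) (show j + 1 ≤ k by omega) (p := p)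
      omega
  · intro h
    exact theta_eq hR ((crossAt_iff hP).2 ⟨h, Or.inl ⟨hp, hq⟩⟩)

theorem lt_of_cross (hP : InStaircase n P) (hR : Reduced n P) {r j p q : ℕ}
    (h : P r (j + 1) = true)
    (hp : pipePos n P r j p = r + j) (hq : pipePos n P r j q = r + j + 1) : p < q := by
  by_contra hcon
  rcases Nat.lt_or_ge q p with hlt | hge
  · obtain ⟨r', j', h₁, h₂⟩ := (pipePos_lt_iff hP hR hlt r j).1 (by omega)
    have := hR _ _ _ _ _ _ h₁ ((crossAt_iff hP).2 ⟨h, Or.inr ⟨hp, hq⟩⟩)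
    omega
  · have : p = q := by omega
    subst this
    omega

theorem theta_le (hP : InStaircase n P) (p q : ℕ) :
    theta n P p q ≤ p := by
  by_contra hcon
  obtain ⟨k, hk⟩ := exists_crossAt (n := n) (P := P) (p := p) (q := q) (by omega)
  obtain ⟨k, rfl⟩ : ∃ k', k = k' + 1 := ⟨k - 1, by have := hk.2.1; omega⟩
  rw [crossAt_iff hP] at hk
  have := pipePos_fix hP (theta n P p q) k (k := p) (by omega)
  omega

theorem tableau_theta (hP : InStaircase n P) (hR : Reduced n P) : Tableau n (theta n P) where
  bal i j k hi hij hjk hk := by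
    have lij := fun r => le_theta_iff hP hR hij (r := r)
    have ljk := fun r => le_theta_iff hP hR hjk (r := r)
    have lik := fun r => le_theta_iff hP hR (hij.trans hjk) (r := r)
    constructor
    · by_contra hcon
      have h₁ := (lij (min (theta n P i j) (theta n P j k)) (by omega)).1 (by omega)
      have h₂ := (ljk (min (theta n P i j) (theta n P j k)) (by omega)).1 (by omega)
      have h₃ := (lik (min (theta n P i j) (theta n P j k)) (by omega)).2 (by omega)
      omega
    · by_contra hcon
      have h₁ := (lij (theta n P i k) (by omega)).not.1 (by omega)
      have h₂ := (ljk (theta n P i k) (by omega)).not.1 (by omega)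
      have h₃ := (lik (theta n P i k) (by omega)).1 le_rfl
      omega
  inj i i' j hi hii hij hj hne heq := by
    obtain ⟨k, hk⟩ := exists_crossAt hne
    obtain ⟨l, hl⟩ := exists_crossAt (n := n) (P := P) (p := i') (q := j) (by omega)
    rw [← heq] at hl
    obtain ⟨k, rfl⟩ : ∃ k', k = k' + 1 := ⟨k - 1, by have := hk.2.1; omega⟩
    obtain ⟨l, rfl⟩ : ∃ k', l = k' + 1 := ⟨l - 1, by have := hl.2.1; omega⟩
    set r := theta n P i j
    rw [crossAt_iff hP] at hk hl
    have aux : ∀ {p m}, p < j → (P r (m + 1) = true ∧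
      ((pipePos n P r m p = r + m ∧ pipePos n P r m j = r + m + 1) ∨
        (pipePos n P r m j = r + m ∧ pipePos n P r m p = r + m + 1))) →
        pipePos n P r m p = r + m ∧ pipePos n P r m j = r + m + 1 ∧
          pipePos n P r (m + 1) j = r + m := by
      rintro p m hpj ⟨h₁, h₂ | h₂⟩
      · refine ⟨h₂.1, h₂.2, ?_⟩
        rw [pipePos_succ, if_neg (by omega), if_pos ⟨h₁, h₂.2⟩]
      · exact absurd (lt_of_cross hP hR h₁ h₂.1 h₂.2) (by omega)
    obtain ⟨k₁, k₂, k₃⟩ := aux (by omega) hk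
    obtain ⟨l₁, l₂, l₃⟩ := aux (by omega) hl
    rcases lt_trichotomy k l with h | h | h
    · have := pipePos_of_lt (n := n) (P := P) (r := r) (j := k + 1) (by omega) (show k + 1 ≤ l by omega) (p := j)
      omega
    · subst h
      exact hii.ne (pipePos_injective r k (k₁.trans l₁.symm))
    · have := pipePos_of_lt (n := n) (P := P) (r := r) (j := l + 1) (by omega) (show l + 1 ≤ k by omega) (p := j)
      omega

end Reduced

section Injectivity

variable {n : ℕ}

theorem permVal_symm {w : Equiv.Perm (Fin n)} {p : ℕ} (h₁ : 1 ≤ p) (h₂ : p ≤ n) :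
    1 ≤ permVal w.symm p ∧ permVal w.symm p ≤ n ∧ permVal w (permVal w.symm p) = p := by
  have h : permVal w.symm p = (w.symm ⟨p - 1, by omega⟩ : ℕ) + 1 := by
    unfold permVal
    rw [dif_pos ⟨h₁, h₂⟩]
  have hlt := (w.symm ⟨p - 1, by omega⟩).isLt
  refine ⟨by omega, by omega, ?_⟩
  rw [h]
  unfold permVal
  rw [dif_pos ⟨by omega, by omega⟩]
  simp only [Nat.add_sub_cancel, Fin.eta, Equiv.apply_symm_apply]
  omega

theorem theta_ne_zero_iff {w : Equiv.Perm (Fin n)} {P : ℕ → ℕ → Bool} (hP : IsPD w P)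
    (hR : Reduced n P) {i j : ℕ} (hi : 1 ≤ i) (hij : i < j) (hj : j ≤ n) :
    theta n P i j ≠ 0 ↔ IsInv w i j := by
  have key : ∀ p, 1 ≤ p → p ≤ n → pipePos n P 1 (n - 1) p = permVal w.symm p := by
    intro p h₁ h₂
    obtain ⟨h₃, h₄, h₅⟩ := permVal_symm (w := w) h₁ h₂
    have h₆ := hP.2 _ h₃ h₄
    rw [h₅, northLabel_eq_iff hP.1 h₃ (by omega)] at h₆
    omega
  have h := le_theta_iff hP.1 hR hij le_rfl
  rw [key i hi (by omega), key j (by omega) hj] at h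
  unfold IsInv
  omega

theorem TableauLE.of_phi_le {w : Equiv.Perm (Fin n)} {P Q : ℕ → ℕ → Bool}
    (hP : IsPD w P ∧ Reduced n P) (hQ : IsPD w Q ∧ Reduced n Q)
    (h : ∀ i j, IsInv w i j → phi n P i j ≤ phi n Q i j) :
    TableauLE n (theta n P) (theta n Q) where
  left := tableau_theta hP.1.1 hP.2
  right := tableau_theta hQ.1.1 hQ.2
  zero i j hi hij hj := by
    rw [← not_iff_not]
    exact (theta_ne_zero_iff hP.1 hP.2 hi hij hj).trans
      (theta_ne_zero_iff hQ.1 hQ.2 hi hij hj).symm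
  le i j hi hij hj hne := h i j ((theta_ne_zero_iff hP.1 hP.2 hi hij hj).1 hne)

theorem TableauLE.antisymm {T U : ℕ → ℕ → ℕ} (h : TableauLE n T U) (h' : TableauLE n U T)
    {i j : ℕ} (hi : 1 ≤ i) (hij : i < j) (hj : j ≤ n) : T i j = U i j := by
  have hz := h.zero i j hi hij hj
  by_cases h₀ : T i j = 0
  · rw [h₀, hz.1 h₀]
  · have key : ∀ t, T i j ≤ t ↔ U i j ≤ t := by
      intro t
      rw [h.left.le_iff hi hij hj h₀, h.right.le_iff hi hij hj (by omega)]
      have h₁ := h.le i j hi hij hj h₀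
      have h₂ := h'.le i j hi hij hj (by omega)
      have h₃ := h.colCount_le hi hij.le hj t
      have h₄ := h'.colCount_le hi hij.le hj t
      omega
    exact le_antisymm ((key _).2 le_rfl) ((key _).1 le_rfl)

theorem eq_of_theta_eq {P Q : ℕ → ℕ → Bool} (hP : InStaircase n P) (hPR : Reduced n P)
    (hQ : InStaircase n Q) (hQR : Reduced n Q)
    (h : ∀ i j, 1 ≤ i → i < j → j ≤ n → theta n P i j = theta n Q i j) : P = Q := by
  have box : ∀ r j, pipeWord n P r j = pipeWord n Q r j → P r (j + 1) = Q r (j + 1) := by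
    intro r j hw
    by_cases hr : 1 ≤ r ∧ r + (j + 1) ≤ n
    · set p := pipeWord n P r j (r + j) with hp
      set q := pipeWord n P r j (r + j + 1) with hq
      have hp' : pipePos n P r j p = r + j := pipeWord_eq_iff.1 hp.symm
      have hq' : pipePos n P r j q = r + j + 1 := pipeWord_eq_iff.1 hq.symm
      have ep := fun hc => pipePos_fix hP r j (k := p) hc
      have eq := fun hc => pipePos_fix hP r j (k := q) hc
      have hne : p ≠ q := fun he => by rw [he] at hp'; omega
      have ht : theta n P p q = theta n Q p q := by
        rcases lt_or_gt_of_ne hne with hlt | hgt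
        · exact h p q (by omega) hlt (by omega)
        · rw [theta_comm hPR, theta_comm hQR]
          exact h q p (by omega) hgt (by omega)
      have h₁ := theta_eq_iff hP hPR hr.1 hp' hq'
      have h₂ := theta_eq_iff hQ hQR hr.1 (p := p) (q := q) (j := j)
        (by rw [← hp']; unfold pipePos; rw [hw]) (by rw [← hq']; unfold pipePos; rw [hw])
      rw [← ht, h₁] at h₂
      exact Bool.eq_iff_iff.2 h₂
    · have h₁ := hP r (j + 1)
      have h₂ := hQ r (j + 1)
      cases hp : P r (j + 1) <;> cases hq : Q r (j + 1) <;> simp_all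
  have word : ∀ r j, pipeWord n P r j = pipeWord n Q r j := by
    apply reading_induction n (C := fun r j => pipeWord n P r j = pipeWord n Q r j)
    · intro r hr
      rw [pipeWord_zero_of_le hr, pipeWord_zero_of_le hr]
    · intro r hr ih
      rw [pipeWord_zero hr, pipeWord_zero hr, ih]
    · intro r j ih
      have hb := box r j ih
      cases hp : P r (j + 1) with
      | false => rw [pipeWord_succ_false hp, pipeWord_succ_false (hb ▸ hp), ih]
      | true => rw [pipeWord_succ_true hp, pipeWord_succ_true (hb ▸ hp), ih]
  funext r j
  cases j with
  | zero =>
    have h₁ := hP r 0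
    have h₂ := hQ r 0
    cases hp : P r 0 <;> cases hq : Q r 0 <;> simp_all
  | succ j => exact box r j (word r j)

theorem eq_of_phi_eq {w : Equiv.Perm (Fin n)} {P Q : ℕ → ℕ → Bool}
    (hP : IsPD w P ∧ Reduced n P) (hQ : IsPD w Q ∧ Reduced n Q)
    (h : ∀ i j, IsInv w i j → phi n P i j = phi n Q i j) : P = Q :=
  eq_of_theta_eq hP.1.1 hP.2 hQ.1.1 hQ.2 fun _ _ hi hij hj =>
    (TableauLE.of_phi_le hP hQ fun i j hinv => (h i j hinv).le).antisymm
      (TableauLE.of_phi_le hQ hP fun i j hinv => (h i j hinv).ge) hi hij hj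

end Injectivity

section Paths

variable {n : ℕ} {P : ℕ → ℕ → Bool}

theorem westLabel_eq_iff' (hP : InStaircase n P) {r j p : ℕ} (hj : 1 ≤ j) (h : r + j ≤ n + 1) :
    westLabel n P r j = p ↔ pipePos n P r (j - 1) p = r + j - 1 := by
  obtain ⟨j, rfl⟩ : ∃ j', j = j' + 1 := ⟨j - 1, by omega⟩
  rw [westLabel_eq_iff hP (by omega), Nat.add_sub_cancel]
  rfl

theorem northLabel_inj (hP : InStaircase n P) {r j k p : ℕ} (hj : 1 ≤ j) (hj' : r + j ≤ n + 1)
    (hk : 1 ≤ k) (hk' : r + k ≤ n + 1) (h₁ : northLabel n P r j = p)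
    (h₂ : northLabel n P r k = p) : j = k := by
  rw [northLabel_eq_iff hP hj hj'] at h₁
  rw [northLabel_eq_iff hP hk hk'] at h₂
  omega

theorem southLabel_inj (hP : InStaircase n P) {r j k p : ℕ} (hj : 1 ≤ j) (hj' : r + j ≤ n)
    (hk : 1 ≤ k) (hk' : r + k ≤ n) (h₁ : southLabel n P r j = p)
    (h₂ : southLabel n P r k = p) : j = k :=
  northLabel_inj hP hj (by omega) hk (by omega) h₁ h₂

theorem lt_of_west_south (hP : InStaircase n P) {r j k p : ℕ} (hj : 1 ≤ j) (hj' : r + j ≤ n + 1)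
    (hk' : r + k ≤ n) (h₁ : westLabel n P r j = p)
    (h₂ : southLabel n P r k = p) : k < j := by
  by_contra hcon
  rw [westLabel_eq_iff' hP hj hj'] at h₁
  rw [southLabel_eq_iff hP (show j - 1 < k by omega) hk'] at h₂
  omega

theorem le_of_west_north (hP : InStaircase n P) {r j k p : ℕ} (hj' : r + j ≤ n + 1)
    (hk : 1 ≤ k) (h₁ : westLabel n P r j = p)
    (h₂ : northLabel n P r k = p) : j ≤ k := by
  by_contra hcon
  rw [westLabel_eq_iff' hP (by omega) hj'] at h₁
  rw [northLabel_eq_iff hP hk (by omega)] at h₂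
  have h₃ : northLabel n P r k = p := (northLabel_eq_iff hP hk (by omega)).2 h₂
  rw [(label_eq hP r (j - 1) (by omega)).2.1 k hk (by omega), pipeWord_eq_iff] at h₃
  omega

theorem le_of_south_north (hP : InStaircase n P) {r j k p : ℕ} (hj' : r + j ≤ n)
    (hk : 1 ≤ k) (h₁ : southLabel n P r j = p)
    (h₂ : northLabel n P r k = p) : j ≤ k := by
  by_contra hcon
  rw [southLabel_eq_iff hP (show k < j by omega) hj'] at h₁
  rw [(label_eq hP r k (by omega)).2.1 k hk (by omega), pipeWord_eq_iff] at h₂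
  omega

theorem northLabel_mem (hP : InStaircase n P) {r j : ℕ} (hj : 1 ≤ j) (hj' : r + j ≤ n + 1) :
    r ≤ northLabel n P r j ∧ northLabel n P r j ≤ n := by
  have h := (northLabel_eq_iff hP hj hj').1 rfl
  by_contra hc
  have := pipePos_fix hP r (n - r) (k := northLabel n P r j) (by omega)
  omega

theorem westLabel_mem (hP : InStaircase n P) {r j : ℕ} (hj : 1 ≤ j) (hj' : r + j ≤ n + 1) :
    r ≤ westLabel n P r j ∧ westLabel n P r j ≤ n := by
  have h := (westLabel_eq_iff' hP hj hj').1 rfl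
  by_contra hc
  have := pipePos_fix hP r (j - 1) (k := westLabel n P r j) (by omega)
  omega

theorem exists_northLabel_eq (hP : InStaircase n P) {r p : ℕ} (h₁ : r ≤ p) (h₂ : p ≤ n) :
    ∃ j, 1 ≤ j ∧ r + j ≤ n + 1 ∧ northLabel n P r j = p := by
  have := pipePos_mem hP r (n - r) ⟨h₁, h₂⟩
  refine ⟨pipePos n P r (n - r) p - r + 1, by omega, by omega, ?_⟩
  rw [northLabel_eq_iff hP (by omega) (by omega)]
  omega

/-- Pipes move weakly to the right on their way up. -/
theorem northLabel_col_mono (hP : InStaircase n P) {r s j k p : ℕ} (hrs : r ≤ s) (hj : 1 ≤ j)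
    (hj' : r + j ≤ n + 1) (hk : 1 ≤ k) (hk' : s + k ≤ n + 1) (h₁ : northLabel n P r j = p)
    (h₂ : northLabel n P s k = p) : k ≤ j := by
  induction s, hrs using Nat.le_induction generalizing k with
  | base => exact (northLabel_inj hP hk hk' hj hj' h₂ h₁).le
  | succ s hs ih =>
    have hp : s + 1 ≤ p ∧ p ≤ n := by
      have := northLabel_mem hP hk hk'
      rwa [h₂] at this
    obtain ⟨l, hl, hl', h₃⟩ := exists_northLabel_eq hP (show s ≤ p by omega) hp.2
    have h₄ := ih hl hl' h₃
    have h₅ : k ≤ l := le_of_south_north hP (by omega) hl (r := s) h₂ h₃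
    omega

theorem northLabel_column (hP : InStaircase n P) {a b j : ℕ}
    (h : ∀ r, a < r → r < b → P r j = true) {r : ℕ} (h₁ : a < r) (h₂ : r ≤ b) :
    northLabel n P r j = northLabel n P b j := by
  induction h₂ using Nat.decreasingInduction with
  | self => rfl
  | of_succ k hk ih => rw [northLabel_true hP (h k h₁ hk)]; exact ih (by omega)

theorem westLabel_row (hP : InStaircase n P) {r c d : ℕ}
    (h : ∀ j, c < j → j < d → P r j = true) {j : ℕ} (h₁ : c < j) (h₂ : j ≤ d) :
    westLabel n P r j = westLabel n P r (c + 1) := by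
  induction j, (show c + 1 ≤ j from h₁) using Nat.le_induction with
  | base => rfl
  | succ k hk ih => rw [westLabel_true hP (h k (by omega) (by omega)), ih (by omega) (by omega)]

theorem west_lt_south (hP : InStaircase n P) (hR : Reduced n P) {r j : ℕ} (h : P r j = true) :
    westLabel n P r j < southLabel n P r j := by
  obtain ⟨h₁, h₂, h₃⟩ := hP _ _ h
  obtain ⟨j, rfl⟩ : ∃ j', j = j' + 1 := ⟨j - 1, by omega⟩
  exact lt_of_cross hP hR h ((westLabel_eq_iff hP (by omega)).1 rfl)
    ((southLabel_eq_iff hP (Nat.lt_succ_self j) h₃).1 rfl)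

theorem theta_west_south (hP : InStaircase n P) (hR : Reduced n P) {r j : ℕ} (h : P r j = true) :
    theta n P (westLabel n P r j) (southLabel n P r j) = r := by
  obtain ⟨h₁, h₂, h₃⟩ := hP _ _ h
  exact theta_eq hR ⟨h₁, h₂, h₃, h, Or.inl ⟨rfl, rfl⟩⟩

theorem theta_west_south_ne (hP : InStaircase n P) (hR : Reduced n P) {r j : ℕ} (h₁ : 1 ≤ r)
    (h₂ : 1 ≤ j) (h₃ : r + j ≤ n) (h : P r j = false) :
    theta n P (westLabel n P r j) (southLabel n P r j) ≠ r := by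
  obtain ⟨j, rfl⟩ : ∃ j', j = j' + 1 := ⟨j - 1, by omega⟩
  rw [Ne, theta_eq_iff hP hR h₁ ((westLabel_eq_iff hP (by omega)).1 rfl)
    ((southLabel_eq_iff hP (Nat.lt_succ_self j) h₃).1 rfl), h]
  simp

/-- A crossing pair of pipes `p < q` crosses at a box with west pipe `p` and south pipe `q`. -/
theorem exists_cross (hP : InStaircase n P) (hR : Reduced n P) {p q : ℕ} (hpq : p < q)
    (h : theta n P p q ≠ 0) : ∃ j, P (theta n P p q) j = true ∧
      westLabel n P (theta n P p q) j = p ∧ southLabel n P (theta n P p q) j = q := by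
  obtain ⟨j, -, -, -, h₁, h₂⟩ := exists_crossAt h
  refine ⟨j, h₁, h₂.resolve_right ?_⟩
  have := west_lt_south hP hR h₁
  omega

/-- Pipes `p < s` cross in row `r` or above iff they are out of order on the north side of row
`r`. -/
theorem le_theta_iff_northLabel (hP : InStaircase n P) (hR : Reduced n P) {p s r j k : ℕ}
    (hps : p < s) (hr : 1 ≤ r) (hj : 1 ≤ j) (hj' : r + j ≤ n + 1) (hk : 1 ≤ k)
    (hk' : r + k ≤ n + 1) (h₁ : northLabel n P r j = p) (h₂ : northLabel n P r k = s) :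
    r ≤ theta n P p s ↔ k < j := by
  rw [northLabel_eq_iff hP hj hj'] at h₁
  rw [northLabel_eq_iff hP hk hk'] at h₂
  rw [le_theta_iff hP hR hps hr]
  omega

end Paths

theorem colCount_congr {T U : ℕ → ℕ → ℕ} {l p j : ℕ} (t : ℕ)
    (h : ∀ i, l ≤ i → i < p → T i j = U i j) : colCount T l p j t = colCount U l p j t := by
  unfold colCount
  congr 1
  apply Finset.filter_congr
  intro i hi
  rw [Finset.mem_Ico] at hi
  rw [h i hi.1 hi.2]

/-- The effect on Lehmer forms of exchanging the entries `a < b` as a chute move does. -/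
theorem lehmer_exchange {n : ℕ} {T T' : ℕ → ℕ → ℕ} (hT : Tableau n T) (hT' : Tableau n T')
    {p q a b : ℕ} {X : ℕ → Prop} (hp : 1 ≤ p) (hpq : p < q) (ha : 0 < a) (hab : a < b)
    (hTpq : T p q = a) (hTpq' : T' p q = b)
    (hX : ∀ v, X v → q < v ∧ T p v = a ∧ T' p v = b ∧ T q v = b ∧ T' q v = a)
    (hne : ∀ u v, u < v → ¬ (u = p ∧ (v = q ∨ X v)) → ¬ (u = q ∧ X v) → T' u v = T u v)
    (hfull : ∀ v, v = q ∨ X v → ∀ r, a < r → r < b → ∃ y, 1 ≤ y ∧ y < p ∧ T y v = r)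
    {u v : ℕ} (hu : 1 ≤ u) (huv : u < v) (hv : v ≤ n) (hnz : T u v ≠ 0) :
    lehmer T u v ≤ lehmer T' u v ∧
      lehmer T' u v ≤ lehmer T u v + if u = p ∧ (v = q ∨ X v) then 1 else 0 := by
  have l₁ := hT.lehmer_add hu huv hv hnz
  by_cases hs : v = q ∨ X v
  · have hpv : T p v = a ∧ T' p v = b ∧ p < v := by
      rcases hs with rfl | hs
      · exact ⟨hTpq, hTpq', hpq⟩
      · have := hX v hs
        exact ⟨this.2.1, this.2.2.1, by omega⟩
    have hf := hfull v hs
    have below : ∀ {m}, m ≤ p → ∀ t, colCount T' 1 m v t = colCount T 1 m v t := fun hm t =>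
      colCount_congr t fun i h₁ h₂ => hne i v (by omega) (by omega) (by omega)
    rcases lt_trichotomy u p with hup | hup | hup
    · have e := hne u v huv (by omega) (by omega)
      have l₂ := hT'.lehmer_add hu huv hv (by omega)
      rw [below hup.le, e] at l₂
      omega
    · subst hup
      rw [if_pos ⟨rfl, hs⟩]
      have l₂ := hT'.lehmer_add hu huv hv (by omega)
      rw [hpv.2.1, below le_rfl] at l₂
      rw [hpv.1] at l₁
      have m := hT.colCount_le_add_sub (p := u) (j := v) huv.le hv hab.le
      have f := le_colCount_of_full (T := T) (p := u) (j := v) (s := a) (t := b - 1) (by omega)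
        fun r h₁ h₂ => hf r h₁ (by omega)
      have f₂ : colCount T 1 u v (b - 1) ≤ colCount T 1 u v b :=
        colCount_le_of_imp fun i _ _ h₁ h₂ => ⟨h₁, by omega⟩
      omega
    · rw [if_neg (by omega)]
      have gap : ¬ (a ≤ T u v ∧ T u v < b) := by
        rintro ⟨h₁, h₂⟩
        rcases h₁.eq_or_lt with h₁ | h₁
        · exact hT.inj p u v hp hup huv hv (by omega) (by omega)
        · obtain ⟨y, h₃, h₄, h₅⟩ := hf _ h₁ h₂
          exact hT.inj y u v h₃ (by omega) huv hv (by omega) h₅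
      have s₁ := fun t => colCount_split T v t hp hup
      have s₂ := fun t => colCount_split T' v t hp hup
      by_cases huq : u < q ∨ ¬ X v
      · have e := hne u v huv (by omega) (by rintro ⟨rfl, h⟩; rcases huq with h' | h' <;> [omega; exact h' h])
        have l₂ := hT'.lehmer_add hu huv hv (by omega)
        have c := colCount_congr (T := T') (U := T) (l := p + 1) (p := u) (j := v) (T u v)
          fun i h₁ h₂ => hne i v (by omega) (by omega)
            (by rintro ⟨rfl, h⟩; rcases huq with h' | h' <;> [omega; exact h' h])
        rw [e, s₂, below le_rfl, c, hpv.2.1] at l₂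
        rw [s₁, hpv.1] at l₁
        split_ifs at l₁ l₂ <;> omega
      · push Not at huq
        have hx := hX v huq.2
        have c : ∀ t, colCount T' (p + 1) q v t = colCount T (p + 1) q v t := fun t =>
          colCount_congr t fun i h₁ h₂ => hne i v (by omega) (by omega) (by omega)
        rcases huq.1.eq_or_lt with rfl | hqu
        · have l₂ := hT'.lehmer_add hu huv hv (by omega)
          rw [hx.2.2.2.2] at l₂
          rw [hx.2.2.2.1] at l₁
          have m := hT'.colCount_le_add_sub (p := q) (j := v) huv.le hv hab.le
          have f := le_colCount_of_full (T := T') (p := q) (j := v) (s := a) (t := b) hab.le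
            fun r h₁ h₂ => by
              by_cases hr : r = b
              · exact ⟨p, hp, hpq, by omega⟩
              · obtain ⟨y, h₃, h₄, h₅⟩ := hf r h₁ (by omega)
                exact ⟨y, h₃, by omega, by rw [hne y v (by omega) (by omega) (by omega), h₅]⟩
          have s₁ := s₁ b
          have s₂ := s₂ b
          rw [hpv.1, if_pos (by omega)] at s₁
          rw [hpv.2.1, if_pos (by omega), below le_rfl, c] at s₂
          omega
        · have e := hne u v huv (by omega) (by omega)
          have l₂ := hT'.lehmer_add hu huv hv (by omega)
          have c₂ := colCount_congr (T := T') (U := T) (l := q + 1) (p := u) (j := v) (T u v)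
            fun i h₁ h₂ => hne i v (by omega) (by omega) (by omega)
          rw [e, s₂, below le_rfl, colCount_split T' v _ (show p + 1 ≤ q from hpq) hqu, c, c₂, hpv.2.1, hx.2.2.2.2] at l₂
          rw [s₁, colCount_split T v _ (show p + 1 ≤ q from hpq) hqu, hpv.1, hx.2.2.2.1] at l₁
          split_ifs at l₁ l₂ <;> omega
  · rw [if_neg (fun h => hs h.2)]
    have e : ∀ i, i < v → T' i v = T i v := fun i hi =>
      hne i v hi (fun h => hs h.2) (fun h => hs (Or.inr h.2))
    have l₂ := hT'.lehmer_add hu huv hv (by rw [e u huv]; exact hnz)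
    rw [e u huv, colCount_congr _ fun i h₁ h₂ => e i (by omega)] at l₂
    omega

section Chute

variable {n : ℕ} {P : ℕ → ℕ → Bool} {a b c d : ℕ}

/-- The pipe labels along a rectangle in which a chute move can take place. -/
structure ChuteLabels (n : ℕ) (P : ℕ → ℕ → Bool) (a b c d p q : ℕ) : Prop where
  west_bot : westLabel n P b c = p
  south_bot : southLabel n P b c = q
  west_bot' : ∀ j, c < j → j ≤ d → westLabel n P b j = q
  north_left : ∀ r, a < r → r ≤ b → northLabel n P r c = p
  west_top : ∀ j, c < j → j ≤ d → westLabel n P a j = p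
  north_right : ∀ r, a < r → r ≤ b → northLabel n P r d = q
  south_mid : ∀ r j, a ≤ r → r ≤ b → c < j → j < d → southLabel n P r j = southLabel n P b j
  west_mid : ∀ r j, a < r → r < b → c ≤ j → j ≤ d → westLabel n P r j = westLabel n P r c

theorem ChuteLabels.south_left {p q : ℕ} (hl : ChuteLabels n P a b c d p q) {r : ℕ} (h₁ : a ≤ r)
    (h₂ : r < b) : southLabel n P r c = p :=
  hl.north_left (r + 1) (by omega) h₂

theorem ChuteLabels.south_right {p q : ℕ} (hl : ChuteLabels n P a b c d p q) {r : ℕ} (h₁ : a ≤ r)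
    (h₂ : r < b) : southLabel n P r d = q :=
  hl.north_right (r + 1) (by omega) h₂

theorem IsChuteRect.labels (hP : InStaircase n P) (h : IsChuteRect n P a b c d) :
    ChuteLabels n P a b c d (westLabel n P b c) (southLabel n P b c) := by
  obtain ⟨ha, hab, hc, hcd, hbd, hac, hbc, hbd', hx⟩ := h
  have hwb : ∀ j, c < j → j ≤ d → westLabel n P b j = southLabel n P b c := by
    intro j h₁ h₂
    rw [westLabel_row hP (c := c) (d := d)
      (fun j h₁ h₂ => hx b j (by omega) le_rfl (by omega) (by omega) (by omega) (by omega) (by omega))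
      h₁ h₂, westLabel_false hc (by omega) hbc]
  have hnl : ∀ r, a < r → r ≤ b → northLabel n P r c = westLabel n P b c := by
    intro r h₁ h₂
    rw [northLabel_column hP (a := a) (b := b) (fun r h₁ h₂ => hx r c (by omega) (by omega) le_rfl
      (by omega) (by omega) (by omega) (by omega)) h₁ h₂, northLabel_false hbc]
  refine ⟨rfl, rfl, hwb, hnl, ?_, ?_, ?_, ?_⟩
  · intro j h₁ h₂
    rw [westLabel_row hP (c := c) (d := d)
      (fun j h₁ h₂ => hx a j le_rfl (by omega) (by omega) (by omega) (by omega) (by omega) (by omega))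
      h₁ h₂, westLabel_false hc (by omega) hac]
    exact hnl (a + 1) (by omega) hab
  · intro r h₁ h₂
    rw [northLabel_column hP (a := a) (b := b) (fun r h₁ h₂ => hx r d (by omega) (by omega) (by omega)
      le_rfl (by omega) (by omega) (by omega)) h₁ h₂, northLabel_false hbd', hwb d hcd le_rfl]
  · intro r j h₁ h₂ h₃ h₄
    exact northLabel_column hP (a := a) (b := b + 1) (fun r h₁ h₂ => hx r j (by omega) (by omega)
      (by omega) (by omega) (by omega) (by omega) (by omega)) (r := r + 1) (by omega) (by omega)
  · intro r j h₁ h₂ h₃ h₄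
    have := westLabel_row hP (r := r) (c := c - 1) (d := d) (fun j h₁ h₂ => hx r j (by omega) (by omega)
      (by omega) (by omega) (by omega) (by omega) (by omega)) (j := j) (by omega) h₄
    rwa [Nat.sub_add_cancel hc] at this

/-- The states of the reading word strictly between the two altered boxes of a chute move. -/
def ChuteMid (a b c d r j : ℕ) : Prop := (r = b ∧ c ≤ j) ∨ (a < r ∧ r < b) ∨ (r = a ∧ j < d)

theorem chuteResult_inStaircase (hP : InStaircase n P) (h : IsChuteRect n P a b c d) :
    InStaircase n (chuteResult P a b c d) := by
  intro i j hij
  obtain ⟨ha, hab, hc, hcd, hbd, -⟩ := h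
  unfold chuteResult at hij
  split_ifs at hij with h₁ h₂
  · omega
  · exact hP i j hij

theorem pipePos_chuteResult (hP : InStaircase n P) (h : IsChuteRect n P a b c d) (r j : ℕ) :
    ∀ u, pipePos n (chuteResult P a b c d) r j u = pipePos n P r j
      (if ChuteMid a b c d r j then
        Equiv.swap (westLabel n P b c) (southLabel n P b c) u else u) := by
  have hl := h.labels hP
  have hr := h
  obtain ⟨ha, hab, hc, hcd, hbd, hac, hbc, hbd', hx⟩ := h
  have had : P a d = true :=
    hx a d le_rfl hab.le hcd.le le_rfl (by omega) (by omega) (by omega)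
  set p := westLabel n P b c with hp
  set q := southLabel n P b c with hq
  obtain ⟨-, -, had'⟩ := hP _ _ had
  refine reading_induction n (C := fun r j => ∀ u, pipePos n (chuteResult P a b c d) r j u =
    pipePos n P r j (if ChuteMid a b c d r j then Equiv.swap p q u else u)) ?_ ?_ ?_ r j
  · intro r hr u
    rw [if_neg (by unfold ChuteMid; omega)]
    simp [pipePos, pipeWord_zero_of_le hr]
  · intro r hr ih u
    rw [pipePos_zero hr, pipePos_zero hr, ih]
    have : ChuteMid a b c d (r + 1) (n - (r + 1)) ↔ ChuteMid a b c d r 0 := by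
      unfold ChuteMid; omega
    simp only [this]
  · intro r j ih u
    have hinj := pipePos_injective (n := n) (P := P) r j
    by_cases h₁ : r = b ∧ j + 1 = c
    · obtain ⟨rfl, rfl⟩ := h₁
      have hpp := (westLabel_eq_iff hP (by omega)).1 hp.symm
      have hqq := (southLabel_eq_iff hP (Nat.lt_succ_self j) (by omega)).1 hq.symm
      rw [pipePos_succ, pipePos_succ, ih, if_neg (show ¬ ChuteMid a r (j + 1) d r j by
        unfold ChuteMid; omega), if_pos (show ChuteMid a r (j + 1) d r (j + 1) by
        unfold ChuteMid; omega)]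
      have ht : chuteResult P a r (j + 1) d r (j + 1) = true := by simp [chuteResult]
      by_cases hup : u = p
      · subst hup
        simp [ht, hpp, hbc, hqq]
        omega
      by_cases huq : u = q
      · subst huq
        simp [ht, hpp, hbc, hqq]
        omega
      · rw [Equiv.swap_apply_of_ne_of_ne hup huq]
        have e₁ : pipePos n P r j u ≠ r + j := fun e => hup (hinj (e.trans hpp.symm))
        have e₂ : pipePos n P r j u ≠ r + j + 1 := fun e => huq (hinj (e.trans hqq.symm))
        simp [ht, hbc, e₁, e₂]
    by_cases h₂ : r = a ∧ j + 1 = d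
    · obtain ⟨rfl, rfl⟩ := h₂
      have hpp := (westLabel_eq_iff hP (by omega)).1 (hl.west_top (j + 1) hcd le_rfl)
      have hqq := (southLabel_eq_iff hP (Nat.lt_succ_self j) (by omega)).1
        (hl.south_right le_rfl hab)
      rw [pipePos_succ, pipePos_succ, ih, if_pos (show ChuteMid r b c (j + 1) r j by
        unfold ChuteMid; omega), if_neg (show ¬ ChuteMid r b c (j + 1) r (j + 1) by
        unfold ChuteMid; omega)]
      have ht : chuteResult P r b c (j + 1) r (j + 1) = false := by
        simp [chuteResult, hab.ne]
      by_cases hup : u = p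
      · subst hup
        simp [ht, hpp, had, hqq]
        omega
      by_cases huq : u = q
      · subst huq
        simp [ht, hpp, had, hqq]
        omega
      · rw [Equiv.swap_apply_of_ne_of_ne hup huq]
        have e₁ : pipePos n P r j u ≠ r + j := fun e => hup (hinj (e.trans hpp.symm))
        have e₂ : pipePos n P r j u ≠ r + j + 1 := fun e => huq (hinj (e.trans hqq.symm))
        simp [ht, e₁, e₂]
    · have : ChuteMid a b c d r (j + 1) ↔ ChuteMid a b c d r j := by
        unfold ChuteMid; omega
      have ht : chuteResult P a b c d r (j + 1) = P r (j + 1) := by simp [chuteResult, h₁, h₂]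
      rw [pipePos_succ, pipePos_succ, ih, ht]
      simp only [this]

theorem chuteResult_isPD {w : Equiv.Perm (Fin n)} (hP : IsPD w P) (h : IsChuteRect n P a b c d) :
    IsPD w (chuteResult P a b c d) := by
  have hS := chuteResult_inStaircase hP.1 h
  refine ⟨hS, fun j h₁ h₂ => ?_⟩
  rw [northLabel_eq_iff hS h₁ (by omega), pipePos_chuteResult hP.1 h, if_neg,
    ← northLabel_eq_iff hP.1 h₁ (by omega), hP.2 j h₁ h₂]
  obtain ⟨ha, hab, hc, hcd, hbd, hac, hbc, hbd', hx⟩ := h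
  unfold ChuteMid; omega

/-- The box of `P` carrying the crossing found at box `(r, j)` after a chute move. -/
def chuteBox (a b c d r j : ℕ) : ℕ × ℕ :=
  if r = b ∧ j = c then (a, d)
  else if c < j ∧ j < d then (if r = a then (b, j) else if r = b then (a, j) else (r, j))
  else if a < r ∧ r < b then (if j = c then (r, d) else if j = d then (r, c) else (r, j))
  else (r, j)

theorem westLabel_chuteResult (hP : InStaircase n P) (h : IsChuteRect n P a b c d) {r j : ℕ}
    (hj : 1 ≤ j) (hrj : r + j ≤ n) {u : ℕ} :
    westLabel n (chuteResult P a b c d) r j = u ↔ westLabel n P r j =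
      if ChuteMid a b c d r (j - 1) then
        Equiv.swap (westLabel n P b c) (southLabel n P b c) u else u := by
  rw [westLabel_eq_iff' (chuteResult_inStaircase hP h) hj (by omega), pipePos_chuteResult hP h,
    ← westLabel_eq_iff' hP hj (by omega)]

theorem southLabel_chuteResult (hP : InStaircase n P) (h : IsChuteRect n P a b c d) {r j : ℕ}
    (hj : 1 ≤ j) (hrj : r + j ≤ n) {u : ℕ} :
    southLabel n (chuteResult P a b c d) r j = u ↔ southLabel n P r j =
      if ChuteMid a b c d r (j - 1) then
        Equiv.swap (westLabel n P b c) (southLabel n P b c) u else u := by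
  rw [southLabel_eq_iff (chuteResult_inStaircase hP h) (show j - 1 < j by omega) hrj,
    pipePos_chuteResult hP h, ← southLabel_eq_iff hP (show j - 1 < j by omega) hrj]

theorem crossAt_of_chuteResult (hP : InStaircase n P) (h : IsChuteRect n P a b c d) {r j u v : ℕ}
    (hc' : CrossAt n (chuteResult P a b c d) r j u v) :
    CrossAt n P (chuteBox a b c d r j).1 (chuteBox a b c d r j).2 u v := by
  have hl := h.labels hP
  set p := westLabel n P b c with hp
  set q := southLabel n P b c with hq
  obtain ⟨hr, hj, hrj, ht, hor⟩ := hc'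
  rw [westLabel_chuteResult hP h hj hrj, westLabel_chuteResult hP h hj hrj,
    southLabel_chuteResult hP h hj hrj, southLabel_chuteResult hP h hj hrj, ← hp, ← hq] at hor
  obtain ⟨ha, hab, hc, hcd, hbd, hac, hbc, hbd', hx⟩ := h
  have key : ∀ r' j', P r' j' = true →
      (∀ u, (westLabel n P r j = if ChuteMid a b c d r (j - 1) then Equiv.swap p q u else u) →
        westLabel n P r' j' = u) →
      (∀ u, (southLabel n P r j = if ChuteMid a b c d r (j - 1) then Equiv.swap p q u else u) →
        southLabel n P r' j' = u) → CrossAt n P r' j' u v := by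
    intro r' j' h₁ h₂ h₃
    obtain ⟨h₄, h₅, h₆⟩ := hP _ _ h₁
    exact ⟨h₄, h₅, h₆, h₁, hor.imp (fun h => ⟨h₂ _ h.1, h₃ _ h.2⟩) fun h => ⟨h₂ _ h.1, h₃ _ h.2⟩⟩
  have sw : ∀ x u, x = Equiv.swap p q u → u = Equiv.swap p q x := by
    rintro x u rfl; simp
  have had : ¬ (r = a ∧ j = d) := by
    rintro ⟨rfl, rfl⟩
    simp [chuteResult, hab.ne] at ht
  unfold chuteBox
  by_cases h₁ : r = b ∧ j = c
  · rw [if_pos h₁]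
    obtain ⟨rfl, rfl⟩ := h₁
    have hm : ¬ ChuteMid a r j d r (j - 1) := by unfold ChuteMid; omega
    refine key a d (hx a d le_rfl hab.le hcd.le le_rfl (by omega) (by omega) (by omega)) ?_ ?_
    · intro u hu
      rw [if_neg hm, hl.west_bot] at hu
      rw [hl.west_top d hcd le_rfl, hu]
    · intro u hu
      rw [if_neg hm, hl.south_bot] at hu
      rw [hl.south_right le_rfl hab, hu]
  rw [if_neg h₁]
  have ht' : P r j = true := by
    unfold chuteResult at ht
    rwa [if_neg h₁, if_neg had] at ht
  by_cases hm : ChuteMid a b c d r (j - 1)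
  swap
  · simp only [if_neg hm] at key
    unfold ChuteMid at hm
    have : (if c < j ∧ j < d then (if r = a then (b, j) else if r = b then (a, j) else (r, j))
      else if a < r ∧ r < b then (if j = c then (r, d) else if j = d then (r, c) else (r, j))
      else (r, j)) = (r, j) := by
      split_ifs <;> first | rfl | omega
    rw [this]
    exact key r j ht' (fun _ h => h) fun _ h => h
  simp only [if_pos hm] at key
  by_cases hin : ((c < j ∧ j < d) ∧ (r = a ∨ r = b)) ∨ ((a < r ∧ r < b) ∧ (j = c ∨ j = d))
  · rcases hin with ⟨h₂, rfl | rfl⟩ | ⟨h₂, rfl | rfl⟩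
    · rw [if_pos h₂, if_pos rfl]
      refine key b j (hx b j hab.le le_rfl h₂.1.le h₂.2.le (by omega) (by omega) (by omega)) ?_ ?_
      · intro u hu
        rw [hl.west_top j h₂.1 h₂.2.le] at hu
        rw [hl.west_bot' j h₂.1 h₂.2.le, sw _ _ hu, Equiv.swap_apply_left]
      · intro u hu
        rw [hl.south_mid r j le_rfl hab.le h₂.1 h₂.2] at hu
        have e₁ : southLabel n P b j ≠ p := fun e => by
          have := lt_of_west_south hP hj (by omega) (by omega)
            (hl.west_top j h₂.1 h₂.2.le) (show southLabel n P r j = p by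
              rw [hl.south_mid r j le_rfl hab.le h₂.1 h₂.2, e])
          omega
        have e₂ : southLabel n P b j ≠ q := fun e => by
          have := southLabel_inj hP hj (by omega) hc (by omega) e hl.south_bot
          omega
        rw [sw _ _ hu, Equiv.swap_apply_of_ne_of_ne e₁ e₂]
    · rw [if_pos h₂, if_neg hab.ne', if_pos rfl]
      refine key a j (hx a j le_rfl hab.le h₂.1.le h₂.2.le (by omega) (by omega) (by omega)) ?_ ?_
      · intro u hu
        rw [hl.west_bot' j h₂.1 h₂.2.le] at hu
        rw [hl.west_top j h₂.1 h₂.2.le, sw _ _ hu, Equiv.swap_apply_right]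
      · intro u hu
        rw [hl.south_mid a j le_rfl hab.le h₂.1 h₂.2]
        have e₁ : southLabel n P r j ≠ p := fun e => by
          have := le_of_south_north hP (by omega) hc e (hl.north_left r hab le_rfl)
          omega
        have e₂ : southLabel n P r j ≠ q := fun e => by
          have := southLabel_inj hP hj (by omega) hc (by omega) e hl.south_bot
          omega
        rw [sw _ _ hu, Equiv.swap_apply_of_ne_of_ne e₁ e₂]
    · rw [if_neg (by omega), if_pos h₂, if_pos rfl]
      have hrd := hx r d h₂.1.le h₂.2.le hcd.le le_rfl (by omega) (by omega) (by omega)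
      have hrd' := hP _ _ hrd
      refine key r d hrd ?_ ?_
      · intro u hu
        rw [hl.west_mid r d h₂.1 h₂.2 hcd.le le_rfl]
        have e₁ : westLabel n P r j ≠ p := fun e => by
          have := lt_of_west_south hP hj (by omega) (by omega) e (hl.south_left h₂.1.le h₂.2)
          omega
        have e₂ : westLabel n P r j ≠ q := fun e => by
          have := lt_of_west_south hP hj (by omega) (by omega) e (hl.south_right h₂.1.le h₂.2)
          omega
        rw [sw _ _ hu, Equiv.swap_apply_of_ne_of_ne e₁ e₂]
      · intro u hu
        rw [hl.south_left h₂.1.le h₂.2] at hu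
        rw [hl.south_right h₂.1.le h₂.2, sw _ _ hu, Equiv.swap_apply_left]
    · rw [if_neg (by omega), if_pos h₂, if_neg hcd.ne', if_pos rfl]
      have hrd := hx r c h₂.1.le h₂.2.le le_rfl hcd.le (by omega) (by omega) (by omega)
      have hrd' := hP _ _ hrd
      refine key r c hrd ?_ ?_
      · intro u hu
        rw [hl.west_mid r j h₂.1 h₂.2 hcd.le le_rfl] at hu
        have e₁ : westLabel n P r c ≠ p := fun e => by
          have := lt_of_west_south hP hc (by omega) (by omega) e (hl.south_left h₂.1.le h₂.2)
          omega
        have e₂ : westLabel n P r c ≠ q := fun e => by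
          have := lt_of_west_south hP hc (by omega) (by omega) e (hl.south_right h₂.1.le h₂.2)
          omega
        rw [sw _ _ hu, Equiv.swap_apply_of_ne_of_ne e₁ e₂]
      · intro u hu
        rw [hl.south_right h₂.1.le h₂.2] at hu
        rw [hl.south_left h₂.1.le h₂.2, sw _ _ hu, Equiv.swap_apply_right]
  · have : (if c < j ∧ j < d then (if r = a then (b, j) else if r = b then (a, j) else (r, j))
      else if a < r ∧ r < b then (if j = c then (r, d) else if j = d then (r, c) else (r, j))
      else (r, j)) = (r, j) := by
      split_ifs <;> first | rfl | omega
    rw [this]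
    have hne₁ : ¬ (r = a ∧ j = c) := by rintro ⟨rfl, rfl⟩; simp [hac] at ht'
    have hne₂ : ¬ (r = b ∧ j = d) := by rintro ⟨rfl, rfl⟩; simp [hbd'] at ht'
    have hra : a ≤ r ∧ r ≤ b := by unfold ChuteMid at hm; omega
    have hW : westLabel n P r j ≠ p ∧ westLabel n P r j ≠ q := by
      constructor <;> intro e
      · by_cases hrb : r < b
        · have h₁ := lt_of_west_south hP hj (by omega) (by omega) e (hl.south_left hra.1 hrb)
          by_cases hra' : a < r
          · have := le_of_west_north hP (by omega) hc e (hl.north_left r hra' hrb.le)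
            omega
          · unfold ChuteMid at hm; omega
        · have := le_of_west_north hP (by omega) hc e (hl.north_left r (by omega) hra.2)
          unfold ChuteMid at hm; omega
      · by_cases hrb : r < b
        · have := hP a d (hx a d le_rfl hab.le hcd.le le_rfl (by omega) (by omega) (by omega))
          have h₁ := lt_of_west_south hP hj (by omega) (by omega) e (hl.south_right hra.1 hrb)
          by_cases hra' : a < r
          · have := le_of_west_north hP (by omega) (by omega) e (hl.north_right r hra' hrb.le)
            omega
          · unfold ChuteMid at hm; omega
        · have := le_of_west_north hP (by omega) (by omega) e (hl.north_right r (by omega) hra.2)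
          unfold ChuteMid at hm; omega
    have hS : southLabel n P r j ≠ p ∧ southLabel n P r j ≠ q := by
      constructor <;> intro e
      · by_cases hrb : r < b
        · have := southLabel_inj hP hj hrj hc (by omega) e (hl.south_left hra.1 hrb)
          omega
        · have := le_of_south_north hP (by omega) hc e (hl.north_left r (by omega) hra.2)
          unfold ChuteMid at hm; omega
      · by_cases hrb : r < b
        · have := southLabel_inj hP hj hrj (by omega) (by omega) e (hl.south_right hra.1 hrb)
          omega
        · have := le_of_south_north hP (by omega) (by omega) e (hl.north_right r (by omega) hra.2)
          unfold ChuteMid at hm; omega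
    refine key r j ht' (fun u hu => ?_) fun u hu => ?_
    · rw [sw _ _ hu, Equiv.swap_apply_of_ne_of_ne hW.1 hW.2]
    · rw [sw _ _ hu, Equiv.swap_apply_of_ne_of_ne hS.1 hS.2]

theorem chuteResult_reduced (hP : InStaircase n P) (hR : Reduced n P)
    (h : IsChuteRect n P a b c d) : Reduced n (chuteResult P a b c d) := by
  intro u v i j i' j' h₁ h₂
  have e := hR _ _ _ _ _ _ (crossAt_of_chuteResult hP h h₁) (crossAt_of_chuteResult hP h h₂)
  obtain ⟨ha, hab, hc, hcd, hbd, -⟩ := h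
  have n₁ : ¬ (i = a ∧ j = d) := by
    rintro ⟨rfl, rfl⟩
    simpa [chuteResult, hab.ne] using h₁.2.2.2.1
  have n₂ : ¬ (i' = a ∧ j' = d) := by
    rintro ⟨rfl, rfl⟩
    simpa [chuteResult, hab.ne] using h₂.2.2.2.1
  unfold chuteBox at e
  split_ifs at e <;> simp only at e <;> omega

theorem exists_crossAt_chuteResult (hP : InStaircase n P) (hR : Reduced n P)
    (h : IsChuteRect n P a b c d) {u v i j : ℕ} (huv : u < v) (hij : CrossAt n P i j u v) :
    ∃ k, CrossAt n (chuteResult P a b c d) (theta n (chuteResult P a b c d) u v) k u v ∧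
      chuteBox a b c d (theta n (chuteResult P a b c d) u v) k = (i, j) := by
  have hS := chuteResult_inStaircase hP h
  have hR' := chuteResult_reduced hP hR h
  have h₁ : 1 ≤ theta n P u v := by rw [theta_eq hR hij]; exact hij.1
  rw [le_theta_iff hP hR huv le_rfl] at h₁
  have h₂ : 1 ≤ theta n (chuteResult P a b c d) u v := by
    rw [le_theta_iff hS hR' huv le_rfl, pipePos_chuteResult hP h, pipePos_chuteResult hP h]
    have : ¬ ChuteMid a b c d 1 (n - 1) := by
      obtain ⟨ha, hab, hc, hcd, hbd, -⟩ := h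
      unfold ChuteMid; omega
    simpa only [if_neg this] using h₁
  obtain ⟨k, hk⟩ := exists_crossAt (show theta n (chuteResult P a b c d) u v ≠ 0 by omega)
  obtain ⟨e₁, e₂⟩ := hR _ _ _ _ _ _ (crossAt_of_chuteResult hP h hk) hij
  exact ⟨k, hk, Prod.ext e₁ e₂⟩

theorem theta_chuteResult (hP : InStaircase n P) (hR : Reduced n P)
    (h : IsChuteRect n P a b c d) {u v i j : ℕ} (huv : u < v) (hij : CrossAt n P i j u v) :
    theta n (chuteResult P a b c d) u v =
      if i = a ∧ c < j ∧ j ≤ d then b else if i = b ∧ c < j ∧ j < d then a else i := by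
  obtain ⟨k, h₁, h₂⟩ := exists_crossAt_chuteResult hP hR h huv hij
  generalize theta n (chuteResult P a b c d) u v = r at *
  obtain ⟨ha, hab, hc, hcd, hbd, -⟩ := h
  have n₁ : ¬ (r = a ∧ k = d) := by
    rintro ⟨rfl, rfl⟩
    simpa [chuteResult, hab.ne] using h₁.2.2.2.1
  unfold chuteBox at h₂
  split_ifs at h₂ ⊢ <;> simp only [Prod.mk.injEq] at h₂ <;> omega

/-- A chute move raises the Lehmer form, and raises it by at most one in boxes `(p, q)` and
`(p, x)` for the pipes `x` crossing the interior of the rectangle vertically. -/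
theorem lehmer_chuteResult (hP : InStaircase n P) (hR : Reduced n P)
    (h : IsChuteRect n P a b c d) {u v : ℕ} (hu : 1 ≤ u) (huv : u < v) (hv : v ≤ n)
    (hnz : theta n P u v ≠ 0) :
    lehmer (theta n P) u v ≤ lehmer (theta n (chuteResult P a b c d)) u v ∧
      lehmer (theta n (chuteResult P a b c d)) u v ≤ lehmer (theta n P) u v +
        if u = westLabel n P b c ∧ (v = southLabel n P b c ∨
          ∃ j, c < j ∧ j < d ∧ v = southLabel n P b j) then 1 else 0 := by
  have hl := h.labels hP
  have hS := chuteResult_inStaircase hP h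
  have hR' := chuteResult_reduced hP hR h
  have key := fun {u v i j} => theta_chuteResult hP hR h (u := u) (v := v) (i := i) (j := j)
  have hw := fun {r j} => west_lt_south hP hR (r := r) (j := j)
  have ht := fun {r j} => theta_west_south hP hR (r := r) (j := j)
  have hcr : ∀ {r j}, P r j = true → CrossAt n P r j (westLabel n P r j) (southLabel n P r j) :=
    fun {r j} h => ⟨(hP _ _ h).1, (hP _ _ h).2.1, (hP _ _ h).2.2, h, Or.inl ⟨rfl, rfl⟩⟩
  set p := westLabel n P b c with hp
  set q := southLabel n P b c with hq
  obtain ⟨ha, hab, hc, hcd, hbd, hac, hbc, hbd', hx⟩ := h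
  have had : P a d = true :=
    hx a d le_rfl hab.le hcd.le le_rfl (by omega) (by omega) (by omega)
  have had₁ := hl.west_top d hcd le_rfl
  have had₂ := hl.south_right le_rfl hab
  have hpq : p < q := by simpa only [had₁, had₂] using hw had
  have hp1 : 1 ≤ p := by
    have := (westLabel_mem hP (r := b) (j := c) hc (by omega)).1
    omega
  have hb : ∀ j, c < j → j < d → P b j = true ∧ P a j = true := fun j h₁ h₂ =>
    ⟨hx b j hab.le le_rfl h₁.le h₂.le (by omega) (by omega) (by omega),
      hx a j le_rfl hab.le h₁.le h₂.le (by omega) (by omega) (by omega)⟩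
  refine lehmer_exchange (tableau_theta hP hR) (tableau_theta hS hR')
    (X := fun v => ∃ j, c < j ∧ j < d ∧ v = southLabel n P b j) hp1 hpq ha hab
    ?_ ?_ ?_ ?_ ?_ hu huv hv hnz
  · simpa only [had₁, had₂] using ht had
  · rw [key hpq (i := a) (j := d) (by simpa only [had₁, had₂] using hcr had),
      if_pos ⟨rfl, hcd, le_rfl⟩]
  · rintro v ⟨j, h₁, h₂, rfl⟩
    obtain ⟨hbj, haj⟩ := hb j h₁ h₂
    have w₁ := hl.west_bot' j h₁ h₂.le
    have w₂ := hl.west_top j h₁ h₂.le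
    have s₂ := hl.south_mid a j le_rfl hab.le h₁ h₂
    have l₁ : q < southLabel n P b j := by simpa only [w₁] using hw hbj
    refine ⟨l₁, by simpa only [w₂, s₂] using ht haj, ?_, by simpa only [w₁] using ht hbj, ?_⟩
    · rw [key (hpq.trans l₁) (by simpa only [w₂, s₂] using hcr haj), if_pos ⟨rfl, h₁, h₂.le⟩]
    · rw [key l₁ (by simpa only [w₁] using hcr hbj), if_neg (by omega), if_pos ⟨rfl, h₁, h₂⟩]
  · intro u v huv h₁ h₂
    by_cases h₀ : theta n P u v = 0
    · rw [h₀]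
      by_contra h₃
      obtain ⟨k, hk⟩ := exists_crossAt h₃
      rw [theta_eq hR (crossAt_of_chuteResult hP ⟨ha, hab, hc, hcd, hbd, hac, hbc, hbd', hx⟩ hk)]
        at h₀
      have := (crossAt_of_chuteResult hP ⟨ha, hab, hc, hcd, hbd, hac, hbc, hbd', hx⟩ hk).1
      omega
    · obtain ⟨j, h₃, h₄, h₅⟩ := exists_cross hP hR huv h₀
      have h₆ := hcr h₃
      rw [h₄, h₅] at h₆
      rw [key huv h₆]
      split_ifs with h₇ h₈
      · exfalso
        apply h₁
        rw [h₇.1, hl.west_top j h₇.2.1 h₇.2.2] at h₄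
        refine ⟨h₄.symm, ?_⟩
        rcases h₇.2.2.eq_or_lt with rfl | h₈
        · left
          rw [h₇.1, had₂] at h₅
          exact h₅.symm
        · right
          rw [h₇.1, hl.south_mid a j le_rfl hab.le h₇.2.1 h₈] at h₅
          exact ⟨j, h₇.2.1, h₈, h₅.symm⟩
      · exfalso
        apply h₂
        rw [h₈.1, hl.west_bot' j h₈.2.1 h₈.2.2.le] at h₄
        rw [h₈.1] at h₅
        exact ⟨h₄.symm, j, h₈.2.1, h₈.2.2, h₅.symm⟩
      · rfl
  · intro v hv r h₁ h₂
    have hrc : P r c = true :=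
      hx r c h₁.le h₂.le le_rfl hcd.le (by omega) (by omega) (by omega)
    have hwr := hw hrc
    rw [hl.south_left h₁.le h₂] at hwr
    have := (westLabel_mem hP (r := r) (j := c) hc (by omega)).1
    refine ⟨westLabel n P r c, by omega, hwr, ?_⟩
    rcases hv with rfl | ⟨j, h₃, h₄, rfl⟩
    · have := ht (hx r d h₁.le h₂.le hcd.le le_rfl (by omega) (by omega) (by omega))
      rwa [hl.west_mid r d h₁ h₂ hcd.le le_rfl, hl.south_right h₁.le h₂] at this
    · have := ht (hx r j h₁.le h₂.le h₃.le h₄.le (by omega) (by omega) (by omega))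
      rwa [hl.west_mid r j h₁ h₂ h₃.le h₄.le, hl.south_mid r j h₁.le h₂.le h₃ h₄] at this

end Chute

section Raising

variable {n : ℕ} {P : ℕ → ℕ → Bool} {U : ℕ → ℕ → ℕ}

/-- Box `(a, d)` is a cross whose horizontal pipe turns into row `a` at `(a, c)`, and whose Lehmer
form is below that of `U`. -/
structure Raisable (n : ℕ) (P : ℕ → ℕ → Bool) (U : ℕ → ℕ → ℕ) (a c d : ℕ) : Prop where
  one_le : 1 ≤ c
  lt : c < d
  bump : P a c = false
  cross : ∀ j, c < j → j ≤ d → P a j = true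
  lehmer_lt : lehmer (theta n P) (westLabel n P a d) (southLabel n P a d) <
    lehmer U (westLabel n P a d) (southLabel n P a d)

theorem exists_last_false (f : ℕ → Bool) (d : ℕ) :
    (∃ c, 1 ≤ c ∧ c < d ∧ f c = false ∧ ∀ j, c < j → j < d → f j = true) ∨
      ∀ j, 1 ≤ j → j < d → f j = true := by
  induction d with
  | zero => exact Or.inr fun j _ h => absurd h (Nat.not_lt_zero j)
  | succ d ih =>
    by_cases hd : 1 ≤ d ∧ f d = false
    · exact Or.inl ⟨d, hd.1, d.lt_succ_self, hd.2, fun j h₁ h₂ => by omega⟩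
    · have hd' : 1 ≤ d → f d = true := fun h => by
        by_contra hc
        exact hd ⟨h, by simpa using hc⟩
      rcases ih with ⟨c, h₁, h₂, h₃, h₄⟩ | h
      · refine Or.inl ⟨c, h₁, by omega, h₃, fun j h₅ h₆ => ?_⟩
        rcases (Nat.lt_succ_iff.1 h₆).eq_or_lt with rfl | h₇
        · exact hd' (by omega)
        · exact h₄ j h₅ h₇
      · refine Or.inr fun j h₅ h₆ => ?_
        rcases (Nat.lt_succ_iff.1 h₆).eq_or_lt with rfl | h₇
        · exact hd' h₅
        · exact h j h₅ h₇

theorem exists_isGreatest {p : ℕ → Prop} (h : ∃ x, p x) (N : ℕ) (hN : ∀ x, p x → x ≤ N) :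
    ∃ x, p x ∧ ∀ y, p y → y ≤ x := by
  obtain ⟨x, hx⟩ := h
  exact ⟨Nat.findGreatest p N, Nat.findGreatest_spec (hN x hx) hx,
    fun y hy => Nat.le_findGreatest (hN y hy) hy⟩

theorem exists_raisable (hP : InStaircase n P) (hR : Reduced n P)
    (h : TableauLE n (theta n P) U) (hU : ∀ i j, U i j ≤ i) {u v : ℕ} (hu : 1 ≤ u) (huv : u < v)
    (hv : v ≤ n) (hnz : theta n P u v ≠ 0) (hlt : lehmer (theta n P) u v < lehmer U u v) :
    ∃ c d, Raisable n P U (theta n P u v) c d ∧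
      westLabel n P (theta n P u v) d = u ∧ southLabel n P (theta n P u v) d = v := by
  obtain ⟨d, h₁, h₂, h₃⟩ := exists_cross hP hR huv hnz
  rcases exists_last_false (P (theta n P u v)) d with ⟨c, h₄, h₅, h₆, h₇⟩ | h₄
  · refine ⟨c, d, ⟨h₄, h₅, h₆, fun j h₈ h₉ => ?_, by rwa [h₂, h₃]⟩, h₂, h₃⟩
    rcases h₉.eq_or_lt with rfl | h₉
    · exact h₁
    · exact h₇ j h₈ h₉
  · exfalso
    have := hP _ _ h₁
    have e := westLabel_row hP (c := 0) (fun j h₅ h₆ => h₄ j h₅ h₆) this.2.1 le_rfl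
    rw [h₂, westLabel_one] at e
    have z := h.zero u v hu huv hv
    have e₁ := h.left.lehmer_add hu huv hv hnz
    have e₂ := (h.right.le_iff hu huv hv (by omega) u).1 (hU u v)
    rw [← e] at e₁
    have l : colCount (theta n P) 1 u v u ≤ colCount U 1 u v u :=
      colCount_le_of_imp fun i h₅ h₆ h₇ _ => by
        have := h.zero i v h₅ (by omega) hv
        have := hU i v
        omega
    omega

/-- Below a run of crosses preceded by a bump, all boxes are crosses down to the next bump below the
initial one. -/
theorem cross_of_run (hP : InStaircase n P) (hR : Reduced n P) {a b c d : ℕ} (hc : 1 ≤ c)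
    (hcd : c < d) (hac : P a c = false) (hrun : ∀ j, c < j → j ≤ d → P a j = true)
    (hcol : ∀ r, a < r → r < b → P r c = true) {r : ℕ} (h₁ : a < r) (h₂ : r < b) :
    ∀ j, c ≤ j → j ≤ d → P r j = true := by
  have had := hP _ _ (hrun d hcd le_rfl)
  have hw : ∀ j, c < j → j ≤ d → westLabel n P a j = southLabel n P a c := by
    intro j h₁ h₂
    rw [westLabel_row hP (c := c) (d := d) (fun j h₁ h₂ => hrun j h₁ h₂.le) h₁ h₂,
      westLabel_false hc (by omega) hac]
  induction r using Nat.strong_induction_on with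
  | _ r ihr =>
  intro j
  induction j using Nat.strong_induction_on with
  | _ j ihj =>
  intro h₃ h₄
  rcases h₃.eq_or_lt with rfl | h₃
  · exact hcol r h₁ h₂
  by_contra hcon
  have e₁ := northLabel_column hP (a := a) (b := r) (j := j)
    (fun s h₅ h₆ => ihr s h₆ h₅ (by omega) j h₃.le h₄) (lt_add_one a) h₁
  have e₂ := northLabel_column hP (a := a) (b := r) (j := c)
    (fun s h₅ h₆ => hcol s h₅ (by omega)) (lt_add_one a) h₁
  have e₃ := westLabel_row hP (r := r) (c := c) (d := j)
    (fun k h₅ h₆ => ihj k h₆ h₅.le (by omega)) h₃ le_rfl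
  rw [northLabel_false (i := r) (j := j) (by simpa using hcon), e₃,
    westLabel_true hP (hcol r h₁ h₂)] at e₁
  rw [northLabel_true hP (hcol r h₁ h₂)] at e₂
  have l₁ := west_lt_south hP hR (hcol r h₁ h₂)
  have l₂ := west_lt_south hP hR (hrun j h₃ h₄)
  rw [hw j h₃ h₄] at l₂
  have e₁' : southLabel n P a j = westLabel n P r c := e₁
  have e₂' : southLabel n P a c = southLabel n P r c := e₂
  omega

/-- If the tableau of `P` is below `U` without having the same Lehmer form, then some chute move
applies to `P` whose result remains below `U`. -/
theorem exists_chuteRect (hP : InStaircase n P) (hR : Reduced n P)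
    (h : TableauLE n (theta n P) U) (hU : ∀ i j, U i j ≤ i) {u v : ℕ} (hu : 1 ≤ u) (huv : u < v)
    (hv : v ≤ n) (hnz : theta n P u v ≠ 0) (hlt : lehmer (theta n P) u v < lehmer U u v) :
    ∃ a b c d, IsChuteRect n P a b c d ∧ ∀ x, (x = southLabel n P b c ∨
      ∃ j, c < j ∧ j < d ∧ x = southLabel n P b j) →
        lehmer (theta n P) (westLabel n P b c) x < lehmer U (westLabel n P b c) x := by
  have bound : ∀ {a c d}, Raisable n P U a c d → a ≤ n ∧ c ≤ n ∧ d ≤ n := fun {a c d} hr => by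
    have := hP _ _ (hr.cross d hr.lt le_rfl)
    have := hr.lt
    omega
  obtain ⟨c₀, d₀, h₀, -⟩ := exists_raisable hP hR h hU hu huv hv hnz hlt
  obtain ⟨c, ⟨a₁, d₁, h₁⟩, maxc⟩ := exists_isGreatest (p := fun c => ∃ a d, Raisable n P U a c d)
    ⟨c₀, _, d₀, h₀⟩ n fun x ⟨_, _, hx⟩ => (bound hx).2.1
  obtain ⟨a, ⟨d₂, h₂⟩, maxa⟩ := exists_isGreatest (p := fun a => ∃ d, Raisable n P U a c d)
    ⟨a₁, d₁, h₁⟩ n fun x ⟨_, hx⟩ => (bound hx).1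
  obtain ⟨d, hd, maxd⟩ := exists_isGreatest (p := fun d => Raisable n P U a c d)
    ⟨d₂, h₂⟩ n fun x hx => (bound hx).2.2
  clear h₀ h₁ h₂ hlt hnz huv hu hv
  obtain ⟨hc, hcd, hac, hrun, hlt⟩ := hd
  have hw := fun {r j} => west_lt_south hP hR (r := r) (j := j)
  have ht := fun {r j} => theta_west_south hP hR (r := r) (j := j)
  have had := hrun d hcd le_rfl
  obtain ⟨ha, -, had'⟩ := hP _ _ had
  have hpq := hw had
  have hTq := ht had
  set p := westLabel n P a d with hp
  set q := southLabel n P a d with hq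
  have hp1 : 1 ≤ p := by
    have := (westLabel_mem hP (r := a) (j := d) (by omega) (by omega)).1
    omega
  have hqn : q ≤ n := (northLabel_mem hP (r := a + 1) (j := d) (by omega) (by omega)).2
  have hwd : p = westLabel n P a (c + 1) :=
    westLabel_row hP (c := c) (d := d) (fun j h₁ h₂ => hrun j h₁ h₂.le) hcd le_rfl
  have hsc : southLabel n P a c = p := by rw [hwd, westLabel_false hc (by omega) hac]
  have hwa : ∀ j, c < j → j ≤ d → westLabel n P a j = p := by
    intro j h₁ h₂
    rw [westLabel_row hP (c := c) (d := d) (fun j h₁ h₂ => hrun j h₁ h₂.le) h₁ h₂, hwd]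
  -- the relative order just below row `a`
  have below : ∀ {i s j k}, i < s → 1 ≤ j → a + j ≤ n → 1 ≤ k → a + k ≤ n →
      southLabel n P a j = i → southLabel n P a k = s → (a + 1 ≤ theta n P i s ↔ k < j) :=
    fun his h₁ h₂ h₃ h₄ h₅ h₆ => le_theta_iff_northLabel hP hR his (r := a + 1) (by omega) h₁
      (by omega) h₃ (by omega) h₅ h₆
  have turn : ∀ {i s}, 1 ≤ i → i < s → s ≤ n → theta n P i s ≠ 0 →
      lehmer (theta n P) i s ≠ lehmer U i s → ∃ c' j, Raisable n P U (theta n P i s) c' j ∧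
        c' ≤ c ∧ westLabel n P (theta n P i s) j = i ∧ southLabel n P (theta n P i s) j = s ∧
        southLabel n P (theta n P i s) c' = i := by
    intro i s hi his hs h₀ hne
    obtain ⟨c', j, h₁, h₂, h₃⟩ := exists_raisable hP hR h hU hi his hs h₀
      (lt_of_le_of_ne (h.le i s hi his hs h₀) hne)
    refine ⟨c', j, h₁, maxc c' ⟨_, _, h₁⟩, h₂, h₃, ?_⟩
    have := hP _ _ (h₁.cross j h₁.lt le_rfl)
    have := h₁.lt
    rw [← westLabel_false h₁.one_le (by omega) h₁.bump]
    exact (westLabel_row hP (fun j h₄ h₅ => h₁.cross j h₄ h₅.le) h₁.lt le_rfl).symm.trans h₂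
  have hor : ∀ i, p < i → i < q → a < theta n P i q → theta n P p i ≠ 0 →
      theta n P p i ≤ a ∧ lehmer (theta n P) p i = lehmer U p i := by
    intro i h₁ h₂ h₃ h₄
    have hb := (h.left.bal p i q hp1 h₁ h₂ hqn).1
    have hle : theta n P p i ≤ a := by omega
    refine ⟨hle, ?_⟩
    by_contra hne
    obtain ⟨c', j, h₅, h₆, h₇, h₈, h₉⟩ := turn hp1 h₁ (by omega) h₄ hne
    have hj := hP _ _ (h₅.cross j h₅.lt le_rfl)
    have := h₅.lt
    rcases hle.eq_or_lt with heq | hlt'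
    · rw [heq] at h₅ h₇ h₈ h₉ hj
      have e := southLabel_inj hP h₅.one_le (by omega) hc (by omega) h₉ hsc
      subst e
      have hjd := maxd j h₅
      have := (below h₂ hj.2.1 (by omega) (by omega) had' h₈ hq.symm).1 h₃
      omega
    · have hap : a ≤ p ∧ p ≤ n := westLabel_mem hP (by omega) (by omega)
      obtain ⟨k, hk₁, hk₂, hk₃⟩ := exists_northLabel_eq hP hap.1 hap.2
      have l₁ := le_of_west_north hP (by omega) hk₁ hp.symm hk₃
      have l₂ := northLabel_col_mono hP (r := theta n P p i + 1) (s := a) hlt' h₅.one_le (by omega)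
        hk₁ hk₂ h₉ hk₃
      omega
  -- the next bump below `(a, c)`
  have hexb : ∃ b, a < b ∧ P b c = false := by
    refine ⟨a + n + 1, by omega, ?_⟩
    by_contra hcon
    have := hP (a + n + 1) c (by simpa using hcon)
    omega
  obtain ⟨b, ⟨hab, hbc⟩, minb⟩ : ∃ b, (a < b ∧ P b c = false) ∧
      ∀ r, a < r → r < b → P r c = true := by
    refine ⟨Nat.find hexb, Nat.find_spec hexb, fun r h₁ h₂ => ?_⟩
    by_contra hcon
    exact Nat.find_min hexb h₂ ⟨h₁, by simpa using hcon⟩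
  have hmid : ∀ r j, a < r → r < b → c ≤ j → j ≤ d → P r j = true := fun r j h₁ h₂ =>
    cross_of_run hP hR hc hcd hac hrun minb h₁ h₂ j
  have hbd : b + d ≤ n + 1 := by
    by_cases hb : b = a + 1
    · omega
    · have := hP _ _ (hmid (b - 1) d (by omega) (by omega) hcd.le le_rfl)
      omega
  have hNb : ∀ j, c ≤ j → j ≤ d → northLabel n P b j = southLabel n P a j := fun j h₁ h₂ =>
    (northLabel_column hP (a := a) (b := b) (fun r h₃ h₄ => hmid r j h₃ h₄ h₁ h₂)
      (lt_add_one a) hab).symm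
  have hwbc : westLabel n P b c = p := by
    rw [← northLabel_false hbc, hNb c le_rfl hcd.le, hsc]
  by_cases hbump : ∃ d', c < d' ∧ d' ≤ d ∧ P b d' = false
  · obtain ⟨d', ⟨hcd', hd'd, hbd'⟩, mind⟩ : ∃ d', (c < d' ∧ d' ≤ d ∧ P b d' = false) ∧
        ∀ j, c < j → j < d' → P b j = true := by
      refine ⟨Nat.find hbump, Nat.find_spec hbump, fun j h₁ h₂ => ?_⟩
      by_contra hcon
      have := (Nat.find_spec hbump).2.1
      exact Nat.find_min hbump h₂ ⟨h₁, by omega, by simpa using hcon⟩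
    have hrect : IsChuteRect n P a b c d' := by
      refine ⟨ha, hab, hc, hcd', by omega, hac, hbc, hbd', ?_⟩
      intro i j h₁ h₂ h₃ h₄ h₅ h₆ h₇
      by_cases hia : i = a
      · subst hia
        exact hrun j (by omega) (by omega)
      · by_cases hib : i = b
        · subst hib
          exact mind j (by omega) (by omega)
        · exact hmid i j (by omega) (by omega) h₃ (by omega)
    have hl := hrect.labels hP
    set q' := southLabel n P b c with hq'
    have had'' := hrun d' hcd' hd'd
    have hsd' := hl.south_right le_rfl hab
    have hpq' : p < q' := by simpa only [hwa d' hcd' hd'd, hsd'] using hw had''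
    have hTq' : theta n P p q' = a := by simpa only [hwa d' hcd' hd'd, hsd'] using ht had''
    have hq'n : q' ≤ n := (northLabel_mem hP (r := b + 1) (j := c) hc (by omega)).2
    -- crossings of `p` in row `a`
    have cross : ∀ {i}, p < i → theta n P p i = a → ∃ j, c < j ∧ a + j ≤ n ∧
        southLabel n P a j = i := by
      intro i hpi hi
      obtain ⟨j, h₁, h₂, h₃⟩ := exists_cross hP hR hpi (by omega)
      rw [hi] at h₁ h₂ h₃
      have hj := hP _ _ h₁
      exact ⟨j, lt_of_west_south hP hj.2.1 (by omega) (by omega) h₂ hsc, hj.2.2, h₃⟩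
    have hxj : ∀ j, c < j → j < d' → q' < southLabel n P b j ∧
        theta n P q' (southLabel n P b j) = b ∧ southLabel n P a j = southLabel n P b j := by
      intro j h₁ h₂
      have e := hl.west_bot' j h₁ h₂.le
      have hbj := mind j h₁ h₂
      exact ⟨by simpa only [e] using hw hbj, by simpa only [e] using ht hbj,
        hl.south_mid a j le_rfl hab.le h₁ h₂⟩
    have main : lehmer (theta n P) p q' < lehmer U p q' := by
      rcases hd'd.eq_or_lt with rfl | hd'd
      · rw [← hsd']
        exact hlt
      rcases lt_trichotomy q q' with hqq | hqq | hqq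
      · refine h.lehmer_lt_of_right hp1 hpq hqq hq'n ha hTq hTq' ?_ hlt ?_
        · exact (below hqq (by omega) had' (by omega) (by omega) hq.symm hsd').2 hd'd
        · intro i h₁ h₂ h₃ h₄ h₅
          obtain ⟨j, h₆, h₇, h₈⟩ := cross h₁ h₃
          rcases lt_trichotomy j d' with hj | hj | hj
          · have := hxj j h₆ hj
            omega
          · rw [hj, hsd'] at h₈
            omega
          · have := (below (by omega) (by omega) h₇ (by omega) (by omega) h₈ hsd').2 hj
            omega
      · rw [← hqq]
        exact hlt
      · have nd : northLabel n P a d = q := northLabel_true hP had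
        have nd' : northLabel n P a d' = q' := by rw [northLabel_true hP had'', hsd']
        have hlt' : theta n P q' q < a := by
          have := le_theta_iff_northLabel hP hR hqq ha (by omega) (by omega) (by omega) (by omega)
            nd' nd
          omega
        refine h.lehmer_lt_of_left hp1 hpq' hqq hqn ha hTq hTq' hlt' hlt ?_
          fun i h₁ h₂ => hor i h₁ (by omega)
        intro h₀
        by_contra hne
        obtain ⟨c', j, h₅, h₆, -, -, h₉⟩ := turn (by omega) hqq hqn h₀ hne
        have hj := hP _ _ (h₅.cross j h₅.lt le_rfl)
        have := h₅.lt
        have := northLabel_col_mono hP (r := theta n P q' q + 1) (s := a) hlt' h₅.one_le (by omega)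
          (by omega) (by omega) h₉ nd'
        omega
    refine ⟨a, b, c, d', hrect, ?_⟩
    rw [hwbc]
    rintro x (rfl | ⟨j, h₁, h₂, rfl⟩)
    · exact main
    · obtain ⟨l, e₁, e₂⟩ := hxj j h₁ h₂
      have haj := hrun j h₁ (by omega)
      have hwj := hwa j h₁ (by omega)
      have hTj := ht haj
      rw [hwj, e₂] at hTj
      have hbj := hP _ _ (mind j h₁ h₂)
      refine h.lehmer_lt_of_right hp1 hpq' l
        (northLabel_mem hP (r := b + 1) (j := j) (by omega) (by omega)).2 ha hTq' hTj (by omega)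
        main ?_
      intro i h₃ h₄ h₅ h₆ h₇
      obtain ⟨k, h₈, h₉, h₁₀⟩ := cross h₃ h₅
      rcases lt_trichotomy k d' with hk | hk | hk
      · have := hxj k h₈ hk
        omega
      · rw [hk, hsd'] at h₁₀
        omega
      · have := (below (by omega) (by omega) h₉ (by omega) (by omega) h₁₀ e₂).2 (by omega)
        omega
  · exfalso
    have hrunb : ∀ j, c < j → j ≤ d → P b j = true := by
      intro j h₁ h₂
      by_contra hcon
      exact hbump ⟨j, h₁, h₂, by simpa using hcon⟩
    have hbd' := hP _ _ (hrunb d hcd le_rfl)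
    have hwb : westLabel n P b d = southLabel n P b c := by
      rw [westLabel_row hP (c := c) (d := d) (fun j h₁ h₂ => hrunb j h₁ h₂.le) hcd le_rfl,
        westLabel_false hc (by omega) hbc]
    have hsb : southLabel n P b d = q := by
      rw [← northLabel_true hP (hrunb d hcd le_rfl), hNb d hcd.le le_rfl]
    have hzq := hw (hrunb d hcd le_rfl)
    have hTz := ht (hrunb d hcd le_rfl)
    have heq : lehmer (theta n P) (westLabel n P b d) (southLabel n P b d) =
        lehmer U (westLabel n P b d) (southLabel n P b d) := by
      have hz1 := (westLabel_mem hP (r := b) (j := d) (by omega) (by omega)).1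
      by_contra hne
      have := maxa b ⟨d, hc, hcd, hbc, hrunb, lt_of_le_of_ne
        (h.le _ _ (by omega) hzq (by omega) (by omega)) hne⟩
      omega
    rw [hwb, hsb] at hzq hTz heq
    set z := southLabel n P b c with hz
    have hz1 : b + 1 ≤ z := (northLabel_mem hP (r := b + 1) (j := c) hc (by omega)).1
    have hfull : ∀ r, a < r → r < b → ∃ y, 1 ≤ y ∧ y < p ∧ theta n P y q = r := by
      intro r h₁ h₂
      have hrc := hmid r c h₁ h₂ le_rfl hcd.le
      have hrd := hmid r d h₁ h₂ hcd.le le_rfl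
      have e₁ : southLabel n P r c = p := by
        rw [← hsc]
        exact (northLabel_column hP (a := a) (b := r + 1)
          (fun s h₃ h₄ => hmid s c h₃ (by omega) le_rfl hcd.le) (lt_add_one a) (by omega)).symm
      have e₂ : southLabel n P r d = q :=
        (northLabel_column hP (a := a) (b := r + 1)
          (fun s h₃ h₄ => hmid s d h₃ (by omega) hcd.le le_rfl) (lt_add_one a) (by omega)).symm
      have e₃ : westLabel n P r d = westLabel n P r c := by
        rw [westLabel_row hP (c := c) (d := d)
          (fun j h₃ h₄ => hmid r j h₁ h₂ h₃.le h₄.le) hcd le_rfl, westLabel_true hP hrc]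
      have l := hw hrc
      have t := ht hrd
      rw [e₁] at l
      rw [e₂, e₃] at t
      have := (westLabel_mem hP (r := r) (j := c) hc (by have := hP _ _ hrc; omega)).1
      exact ⟨_, by omega, l, t⟩
    rcases lt_trichotomy p z with hpz | hpz | hpz
    · exact h.false_of_blocked_right hp1 hpz hzq hqn ha hab hTq hTz hlt heq hfull
        fun i h₁ h₂ => hor i h₁ (by omega)
    · have := lt_of_west_south hP hc (by omega) (by omega) hwbc (hz.symm.trans hpz.symm)
      omega
    · refine h.false_of_blocked_left (by omega) hpz hpq hqn ha hab hTq hTz ?_ hlt heq hfull ?_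
      · have h₁ := theta_west_south_ne hP hR (r := b) (j := c) (by omega) hc (by omega) hbc
        rw [hwbc, ← hz, theta_comm hR] at h₁
        have h₂ := (westLabel_eq_iff' hP hc (by omega)).1 hwbc
        have h₃ := (southLabel_eq_iff hP (show c - 1 < c by omega) (by omega)).1 hz.symm
        have h₄ := le_theta_of_pipePos_lt hP hR hpz (r := b) (j := c - 1) (by omega)
        omega
      · intro i h₁ h₂ h₃ h₄ h₅
        obtain ⟨j, h₆, h₇, h₈⟩ := exists_cross hP hR h₁ (by omega)
        rw [h₃] at h₆ h₇ h₈
        have hj := hP _ _ h₆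
        have hcj := lt_of_west_south hP hj.2.1 (by omega) (by omega) h₇ hz.symm
        have n₁ : northLabel n P b j = i := by rw [northLabel_true hP h₆, h₈]
        have n₂ : northLabel n P b d = q := hNb d hcd.le le_rfl
        have := le_theta_iff_northLabel hP hR (show i < q by omega) (by omega) hj.2.1 (by omega)
          (by omega) (by omega) n₁ n₂
        have l := hw (hrun j hcj (by omega))
        rw [hwa j hcj (by omega), ← hNb j hcj.le (by omega), n₁] at l
        omega

end Raising

section Order

variable {n : ℕ} {w : Equiv.Perm (Fin n)}

theorem phi_le_of_chuteLE {P Q : RPD w} (h : chuteLE w P Q) {i j : ℕ} (hij : IsInv w i j) :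
    phi n P.1 i j ≤ phi n Q.1 i j := by
  induction h with
  | refl => exact le_rfl
  | @tail X Y _ hXY ih =>
    refine ih.trans ?_
    obtain ⟨a, b, c, d, hr, hY⟩ := hXY
    obtain ⟨h₁, h₂, h₃, -⟩ := id hij
    rw [hY]
    exact (lehmer_chuteResult X.2.1.1 X.2.2 hr h₁ h₂ h₃
      ((theta_ne_zero_iff X.2.1 X.2.2 h₁ h₂ h₃).2 hij)).1

theorem exists_chuteStep {P Q : RPD w} (hne : P ≠ Q)
    (h : ∀ i j, IsInv w i j → phi n P.1 i j ≤ phi n Q.1 i j) :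
    ∃ P' : RPD w, ChuteStep n P.1 P'.1 ∧ P' ≠ P ∧
      ∀ i j, IsInv w i j → phi n P'.1 i j ≤ phi n Q.1 i j := by
  obtain ⟨u, v, huv, hlt⟩ : ∃ u v, IsInv w u v ∧ phi n P.1 u v < phi n Q.1 u v := by
    by_contra! hcon
    exact hne (Subtype.ext (eq_of_phi_eq P.2 Q.2 fun i j hij => le_antisymm (h i j hij)
      (hcon i j hij)))
  have nz := fun {i j} (hij : IsInv w i j) =>
    (theta_ne_zero_iff P.2.1 P.2.2 hij.1 hij.2.1 hij.2.2.1).2 hij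
  obtain ⟨a, b, c, d, hr, hx⟩ := exists_chuteRect P.2.1.1 P.2.2 (TableauLE.of_phi_le P.2 Q.2 h)
    (theta_le Q.2.1.1) huv.1 huv.2.1 huv.2.2.1 (nz huv) hlt
  refine ⟨⟨chuteResult P.1 a b c d, chuteResult_isPD P.2.1 hr,
    chuteResult_reduced P.2.1.1 P.2.2 hr⟩, ⟨a, b, c, d, hr, rfl⟩, ?_, ?_⟩
  · intro e
    have e' := congrFun (congrFun (congrArg Subtype.val e) b) c
    rw [hr.2.2.2.2.2.2.1] at e'
    simp [chuteResult] at e'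
  · intro i j hij
    have l := (lehmer_chuteResult P.2.1.1 P.2.2 hr hij.1 hij.2.1 hij.2.2.1 (nz hij)).2
    have l' := h i j hij
    change phi n (chuteResult P.1 a b c d) i j ≤ _
    unfold phi at l' ⊢
    split_ifs at l with hc
    · obtain ⟨rfl, hc⟩ := hc
      have := hx j hc
      omega
    · omega

theorem chuteLE_of_phi_le (P Q : RPD w)
    (h : ∀ i j, IsInv w i j → phi n P.1 i j ≤ phi n Q.1 i j) : chuteLE w P Q := by
  let s := ((Finset.range (n + 1)) ×ˢ (Finset.range (n + 1))).filter fun x => IsInv w x.1 x.2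
  let f : RPD w → ℕ := fun P => ∑ x ∈ s, (phi n Q.1 x.1 x.2 - phi n P.1 x.1 x.2)
  have hs : ∀ x, x ∈ s → IsInv w x.1 x.2 := fun x hx => (Finset.mem_filter.1 hx).2
  induction hf : f P using Nat.strong_induction_on generalizing P with
  | _ m ih =>
  by_cases hne : P = Q
  · rw [hne]
    exact Relation.ReflTransGen.refl
  obtain ⟨P', hstep, hne', hle⟩ := exists_chuteStep hne h
  have hmono := fun {i j} (hij : IsInv w i j) =>
    phi_le_of_chuteLE (P := P) (Q := P') (Relation.ReflTransGen.single hstep) hij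
  obtain ⟨i, j, hij, hlt⟩ : ∃ i j, IsInv w i j ∧ phi n P.1 i j < phi n P'.1 i j := by
    by_contra! hcon
    exact hne' (Subtype.ext (eq_of_phi_eq P'.2 P.2 fun i j hij => le_antisymm (hcon i j hij)
      (hmono hij)))
  refine Relation.ReflTransGen.head hstep (ih (f P') ?_ P' hle rfl)
  rw [← hf]
  refine Finset.sum_lt_sum (fun x hx => ?_) ⟨(i, j), ?_, ?_⟩
  · have := hmono (hs x hx)
    omega
  · obtain ⟨-, h₂, h₃, -⟩ := id hij
    exact Finset.mem_filter.2 ⟨Finset.mem_product.2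
      ⟨Finset.mem_range.2 (by dsimp; omega), Finset.mem_range.2 (by dsimp; omega)⟩, hij⟩
  · have := hle i j hij
    dsimp
    omega

end Order

/-- `Φ` is a poset isomorphism from the chute move poset `PD(w)` onto the
set of Lehmer tableaux for `w` with the componentwise order: it is injective, and
`P ≤_chute Q` iff `Φ(P) ≤ Φ(Q)` componentwise. -/
theorem phi_isomorphism {n : ℕ} (w : Equiv.Perm (Fin n)) :
    (∀ P Q : RPD w, (∀ i j, IsInv w i j → phi n P.1 i j = phi n Q.1 i j) → P = Q) ∧
      ∀ P Q : RPD w,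
        chuteLE w P Q ↔ ∀ i j, IsInv w i j → phi n P.1 i j ≤ phi n Q.1 i j := by
  exact ⟨fun P Q h => Subtype.ext (eq_of_phi_eq P.2 Q.2 h), fun P Q =>
    ⟨fun h _ _ hij => phi_le_of_chuteLE h hij, chuteLE_of_phi_le P Q⟩⟩
end
end
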